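/- arXiv:2304.11021 — 4 statements merged into one kernel-verified Lean document; each statement's English description precedes it below -/
import Mathlib

section
/- Let Γ(0,b,c,d) with 0 ≤ b ≤ c ≤ d < b+c+3. Then Γ is doubly Eulerian if and only if Γ is bipartite (equivalently, b, c, d are all even). -/
open SimpleGraph

/-- Two closed walks from the same vertex are *avoiding* if at every intermediate
step their current vertices are distinct and non-adjacent. -/
def Avoiding {V : Type*} (G : SimpleGraph V) {u : V} (p q : G.Walk u u) : Prop :=
  ∀ i : ℕ, 0 < i → i < p.length →
    p.getVert i ≠ q.getVert i ∧ ¬ G.Adj (p.getVert i) (q.getVert i)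

/-- A graph is *doubly Eulerian* if from every vertex there exist two avoiding
Eulerian circuits. -/
def DoublyEulerian {V : Type*} [DecidableEq V] (G : SimpleGraph V) : Prop :=
  ∀ u : V, ∃ p q : G.Walk u u, p.IsEulerian ∧ q.IsEulerian ∧ Avoiding G p q


/-- The vertex set of the graph `Γ(a,b,c,d)`: the two degree-4 vertices together
with the internal vertices of the four paths `A`, `B`, `C`, `D`. -/
abbrev GammaV (a b c d : ℕ) : Type := Fin 2 ⊕ (Fin a ⊕ (Fin b ⊕ (Fin c ⊕ Fin d)))

/-- The relation describing a path from `u` to `v` whose internal vertices are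
`f 0, f 1, …, f (k-1)`. -/
def pathRel {V : Type*} (u v : V) {k : ℕ} (f : Fin k → V) (x y : V) : Prop :=
  (∃ i : Fin k, (i : ℕ) = 0 ∧ x = u ∧ y = f i) ∨
  (∃ i j : Fin k, (j : ℕ) = (i : ℕ) + 1 ∧ x = f i ∧ y = f j) ∨
  (∃ i : Fin k, (i : ℕ) = k - 1 ∧ x = f i ∧ y = v)

/-- The graph `Γ(a,b,c,d)`: two vertices `u = Sum.inl 0` and `v = Sum.inl 1` of
degree 4 joined by four internally disjoint paths `A`, `B`, `C`, `D` having
respectively `a`, `b`, `c`, `d` internal vertices of degree 2 (an empty path is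
replaced by the edge `u v`). -/
def Gamma (a b c d : ℕ) : SimpleGraph (GammaV a b c d) :=
  SimpleGraph.fromRel (fun x y =>
    (x = Sum.inl 0 ∧ y = Sum.inl 1 ∧ (a = 0 ∨ b = 0 ∨ c = 0 ∨ d = 0)) ∨
    pathRel (Sum.inl 0) (Sum.inl 1) (fun i : Fin a => Sum.inr (Sum.inl i)) x y ∨
    pathRel (Sum.inl 0) (Sum.inl 1) (fun i : Fin b => Sum.inr (Sum.inr (Sum.inl i))) x y ∨
    pathRel (Sum.inl 0) (Sum.inl 1) (fun i : Fin c => Sum.inr (Sum.inr (Sum.inr (Sum.inl i)))) x y ∨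
    pathRel (Sum.inl 0) (Sum.inl 1) (fun i : Fin d => Sum.inr (Sum.inr (Sum.inr (Sum.inr i)))) x y)


/-- `IsTheta G u v n P` says that `G` is the union of four internally disjoint paths from `u` to
`v`, where the `k`-th path has `n k` edges and visits `P k 0, …, P k (n k)`. -/
structure IsTheta {V : Type*} (G : SimpleGraph V) (u v : V) (n : Fin 4 → ℕ)
    (P : Fin 4 → ℕ → V) : Prop where
  pos : ∀ k, 0 < n k
  map_zero : ∀ k, P k 0 = u
  map_length : ∀ k, P k (n k) = v
  adj : ∀ k i, i < n k → G.Adj (P k i) (P k (i + 1))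
  edge : ∀ x y, G.Adj x y → ∃ k i, i < n k ∧ s(x, y) = s(P k i, P k (i + 1))
  inj : ∀ k l i j, i ≤ n k → j ≤ n l → P k i = P l j →
    (k = l ∧ i = j) ∨ (i = 0 ∧ j = 0) ∨ (i = n k ∧ j = n l)
  simple : ∀ k l, k ≠ l → n k = 1 → n l ≠ 1

/-- A walk along consecutive values of a function. -/
theorem exists_walk_along {V : Type*} {G : SimpleGraph V} (f : ℕ → V) (a m : ℕ)
    (hf : ∀ i, a ≤ i → i < a + m → G.Adj (f i) (f (i + 1))) {x y : V}
    (hx : f a = x) (hy : f (a + m) = y) :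
    ∃ w : G.Walk x y, w.length = m ∧ (∀ t ≤ m, w.getVert t = f (a + t)) ∧
      w.edges = (List.range' a m).map fun i => s(f i, f (i + 1)) := by
  subst hx
  induction m generalizing a with
  | zero => subst hy; exact ⟨.nil, rfl, by simp, by simp⟩
  | succ m ih =>
    obtain ⟨w, hl, hv, he⟩ := ih (a + 1) (fun i h₁ h₂ => hf i (by omega) (by omega))
      (by rw [← hy]; congr 1; omega)
    refine ⟨.cons (hf a le_rfl (by omega)) w, by simp [hl], fun t ht => ?_, by
      simp [he, List.range'_succ]⟩
    cases t with
    | zero => simp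
    | succ t =>
      rw [Walk.getVert_cons_succ, hv t (by omega)]
      congr 1
      omega

theorem sum_eq_of_nodup (n : Fin 4 → ℕ) {k a b c : Fin 4} (hd : [k, a, b, c].Nodup) :
    ∑ l, n l = n k + n a + n b + n c := by
  have huniv : [k, a, b, c].toFinset = Finset.univ :=
    Finset.eq_univ_of_card _ (by rw [List.toFinset_card_of_nodup hd]; rfl)
  rw [← huniv, List.sum_toFinset _ hd]
  simp [add_assoc]

namespace IsTheta

variable {V : Type*} {G : SimpleGraph V} {u v : V} {n : Fin 4 → ℕ} {P : Fin 4 → ℕ → V}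

/-- Traversing all four paths backwards. -/
theorem reflect (h : IsTheta G u v n P) : IsTheta G v u n fun k i => P k (n k - i) where
  pos := h.pos
  map_zero k := by simpa using h.map_length k
  map_length k := by simpa using h.map_zero k
  adj k i hi := by
    have := h.adj k (n k - (i + 1)) (by omega)
    rw [show n k - (i + 1) + 1 = n k - i by omega] at this
    exact this.symm
  edge x y hxy := by
    obtain ⟨k, i, hi, e⟩ := h.edge x y hxy
    refine ⟨k, n k - (i + 1), by omega, ?_⟩
    rw [e, show n k - (n k - (i + 1)) = i + 1 by omega,
      show n k - (n k - (i + 1) + 1) = i by omega, Sym2.eq_swap]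
  inj k l i j hi hj e := by
    have := h.inj k l (n k - i) (n l - j) (by omega) (by omega) e
    have hk := h.pos k
    have hl := h.pos l
    rcases this with ⟨rfl, _⟩ | _ | _ <;> omega
  simple := h.simple

theorem edge_inj (h : IsTheta G u v n P) {k l : Fin 4} {i j : ℕ} (hi : i < n k) (hj : j < n l)
    (e : s(P k i, P k (i + 1)) = s(P l j, P l (j + 1))) : k = l ∧ i = j := by
  rcases Sym2.eq_iff.1 e with ⟨e₁, e₂⟩ | ⟨e₁, e₂⟩
  · have := h.inj _ _ _ _ hi.le hj.le e₁
    have := h.inj _ _ _ _ hi hj e₂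
    by_cases hkl : k = l
    · subst hkl
      exact ⟨rfl, by omega⟩
    · have := h.simple k l hkl
      omega
  · have := h.inj _ _ _ _ hi.le hj e₁
    have := h.inj _ _ _ _ hi hj.le e₂
    omega

/-- The neighbours of an internal vertex of a path. -/
theorem eq_or_eq_of_adj (h : IsTheta G u v n P) {k : Fin 4} {i : ℕ} (h₀ : 0 < i) (hi : i < n k)
    {x : V} (hx : G.Adj (P k i) x) : x = P k (i + 1) ∨ x = P k (i - 1) := by
  obtain ⟨l, j, hj, e⟩ := h.edge _ _ hx
  rcases Sym2.eq_iff.1 e with ⟨e₁, rfl⟩ | ⟨e₁, rfl⟩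
  · rcases h.inj _ _ _ _ hi.le hj.le e₁ with ⟨rfl, rfl⟩ | _ | _
    · exact .inl rfl
    all_goals omega
  · rcases h.inj _ _ _ _ hi.le hj e₁ with ⟨rfl, rfl⟩ | _ | _
    · exact .inr (by simp)
    all_goals omega

/-- When all four paths have odd length, `G` is bipartite. -/
theorem odd_of_adj (h : IsTheta G u v n P) (hodd : ∀ k, n k % 2 = 1) {k l : Fin 4} {i j : ℕ}
    (hi : i ≤ n k) (hj : j ≤ n l) (hx : G.Adj (P k i) (P l j)) : (i + j) % 2 = 1 := by
  obtain ⟨m, r, hr, e⟩ := h.edge _ _ hx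
  have := hodd k
  have := hodd l
  have := hodd m
  rcases Sym2.eq_iff.1 e with ⟨e₁, e₂⟩ | ⟨e₁, e₂⟩
  · rcases h.inj _ _ _ _ hi hr.le e₁ with ⟨rfl, _⟩ | _ | _ <;>
    rcases h.inj _ _ _ _ hj hr e₂ with ⟨rfl, _⟩ | _ | _ <;> omega
  · rcases h.inj _ _ _ _ hi hr e₁ with ⟨rfl, _⟩ | _ | _ <;>
    rcases h.inj _ _ _ _ hj hr.le e₂ with ⟨rfl, _⟩ | _ | _ <;> omega

/-- Consider the closed walk which starts at distance `i` from `u` on the path `k`, goes to `v`,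
traverses the paths `a`, `b`, `c` in this order, and returns to its start from `u`. At time `t` it is
on the path `l`, at distance `x` from `u`. -/
def CircuitPos (n : Fin 4 → ℕ) (k a b c : Fin 4) (i t : ℕ) (l : Fin 4) (x : ℕ) : Prop :=
  (l = k ∧ x ≤ n k ∧ x = i + t) ∨
  (l = a ∧ x ≤ n a ∧ t + x + i = n k + n a) ∨
  (l = b ∧ x ≤ n b ∧ t + i = n k + n a + x) ∨
  (l = c ∧ x ≤ n c ∧ t + x + i = n k + n a + n b + n c) ∨
  (l = k ∧ x ≤ i ∧ t + i = n k + n a + n b + n c + x)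

theorem exists_circuit [DecidableEq V] (h : IsTheta G u v n P) {k a b c : Fin 4} {i : ℕ}
    (hi : i ≤ n k) (hd : [k, a, b, c].Nodup) :
    ∃ p : G.Walk (P k i) (P k i), p.IsEulerian ∧ p.length = n k + n a + n b + n c ∧
      ∀ t ≤ n k + n a + n b + n c,
        ∃ l x, CircuitPos n k a b c i t l x ∧ p.getVert t = P l x := by
  obtain ⟨R, hRl, hRv, hRe⟩ := exists_walk_along (P k) 0 i (fun j _ hj => h.adj k j (by omega))
    (h.map_zero k) (congrArg (P k) (Nat.zero_add i))
  obtain ⟨S, hSl, hSv, hSe⟩ := exists_walk_along (P k) i (n k - i)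
    (fun j _ hj => h.adj k j (by omega)) rfl
    ((congrArg (P k) (by omega : i + (n k - i) = n k)).trans (h.map_length k))
  have hpath : ∀ l, ∃ w : G.Walk u v, w.length = n l ∧ (∀ t ≤ n l, w.getVert t = P l t) ∧
      w.edges = (List.range' 0 (n l)).map fun i => s(P l i, P l (i + 1)) := fun l => by
    simpa using exists_walk_along (P l) 0 (n l) (fun j _ hj => h.adj l j (by omega))
      (h.map_zero l) ((congrArg (P l) (Nat.zero_add _)).trans (h.map_length l))
  choose Q hQl hQv hQe using hpath
  let p := S.append ((Q a).reverse.append ((Q b).append ((Q c).reverse.append R)))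
  have hlen : p.length = n k + n a + n b + n c := by
    simp only [p, Walk.length_append, Walk.length_reverse, hRl, hSl, hQl]
    omega
  have hedges : p.edges = ((List.range' i (n k - i)).map fun j => s(P k j, P k (j + 1))) ++
      (((List.range' 0 (n a)).map fun j => s(P a j, P a (j + 1))).reverse ++
      (((List.range' 0 (n b)).map fun j => s(P b j, P b (j + 1))) ++
      (((List.range' 0 (n c)).map fun j => s(P c j, P c (j + 1))).reverse ++
      ((List.range' 0 i).map fun j => s(P k j, P k (j + 1)))))) := by
    simp only [p, Walk.edges_append, Walk.edges_reverse, hRe, hSe, hQe]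
  simp only [List.nodup_cons, List.mem_cons, not_or, List.not_mem_nil, not_false_eq_true,
    and_true] at hd
  obtain ⟨⟨hka, hkb, hkc⟩, ⟨hab, hac⟩, hbc, -⟩ := hd
  have hmap : ∀ l s m, s + m ≤ n l →
      ((List.range' s m).map fun j => s(P l j, P l (j + 1))).Nodup := fun l s m hm =>
    (List.nodup_map_iff_inj_on (List.nodup_range' ..)).2 fun x hx y hy e => by
      rw [List.mem_range'_1] at hx hy
      exact (h.edge_inj (by omega) (by omega) e).2
  have hnodup : p.edges.Nodup := by
    have hne := @h.edge_inj
    rw [hedges]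
    simp only [List.nodup_append, List.nodup_reverse, List.mem_append, List.mem_reverse,
      List.mem_map, List.mem_range'_1]
    refine ⟨hmap _ _ _ (by omega), ⟨hmap _ _ _ (by omega), ⟨hmap _ _ _ (by omega),
      ⟨hmap _ _ _ (by omega), hmap _ _ _ (by omega), ?_⟩, ?_⟩, ?_⟩, ?_⟩
    · rintro _ ⟨x, hx, rfl⟩ _ ⟨y, hy, rfl⟩ e
      exact hkc (hne (by omega) (by omega) e).1.symm
    · rintro _ ⟨x, hx, rfl⟩ _ (⟨y, hy, rfl⟩ | ⟨y, hy, rfl⟩) e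
      · exact hbc (hne (by omega) (by omega) e).1
      · exact hkb (hne (by omega) (by omega) e).1.symm
    · rintro _ ⟨x, hx, rfl⟩ _ (⟨y, hy, rfl⟩ | ⟨y, hy, rfl⟩ | ⟨y, hy, rfl⟩) e
      · exact hab (hne (by omega) (by omega) e).1
      · exact hac (hne (by omega) (by omega) e).1
      · exact hka (hne (by omega) (by omega) e).1.symm
    · rintro _ ⟨x, hx, rfl⟩ _ (⟨y, hy, rfl⟩ | ⟨y, hy, rfl⟩ | ⟨y, hy, rfl⟩ | ⟨y, hy, rfl⟩) e
      · exact hka (hne (by omega) (by omega) e).1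
      · exact hkb (hne (by omega) (by omega) e).1
      · exact hkc (hne (by omega) (by omega) e).1
      · have := (hne (by omega) (by omega) e).2
        omega
  refine ⟨p, fun e he => List.count_eq_one_of_mem hnodup ?_, hlen, fun t ht => ?_⟩
  · induction e with | _ x y
    obtain ⟨l, j, hj, e⟩ := h.edge x y he
    have hl : l = k ∨ l = a ∨ l = b ∨ l = c := by omega
    simp only [hedges, List.mem_append, List.mem_reverse, List.mem_map, List.mem_range'_1]
    rcases hl with rfl | rfl | rfl | rfl
    · rcases lt_or_ge j i with hji | hji
      · exact .inr (.inr (.inr (.inr ⟨j, by omega, e.symm⟩)))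
      · exact .inl ⟨j, by omega, e.symm⟩
    · exact .inr (.inl ⟨j, by omega, e.symm⟩)
    · exact .inr (.inr (.inl ⟨j, by omega, e.symm⟩))
    · exact .inr (.inr (.inr (.inl ⟨j, by omega, e.symm⟩)))
  · simp only [p, Walk.getVert_append, Walk.getVert_reverse, Walk.length_reverse, hSl, hQl]
    split_ifs with h₁ h₂ h₃ h₄
    · exact ⟨k, _, .inl ⟨rfl, by omega, rfl⟩, hSv _ (by omega)⟩
    · exact ⟨a, _, .inr (.inl ⟨rfl, by omega, by omega⟩), hQv _ _ (by omega)⟩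
    · exact ⟨b, _, .inr (.inr (.inl ⟨rfl, by omega, by omega⟩)), hQv _ _ (by omega)⟩
    · exact ⟨c, _, .inr (.inr (.inr (.inl ⟨rfl, by omega, by omega⟩))), hQv _ _ (by omega)⟩
    · exact ⟨k, _, .inr (.inr (.inr (.inr ⟨rfl, by omega, by omega⟩))), hRv _ (by omega)⟩

/-- Two circuits in opposite directions from the same vertex are avoiding if their schedules never
put them on the same vertex. -/
theorem exists_avoiding [DecidableEq V] (h : IsTheta G u v n P) (hodd : ∀ k, n k % 2 = 1)
    {k a b c a' b' c' : Fin 4} {i : ℕ} (hi : i ≤ n k) (hd : [k, a, b, c].Nodup)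
    (hd' : [k, a', b', c'].Nodup)
    (hne : ∀ t s l m x y, 0 < t → 0 < s → t + s = n k + n a + n b + n c →
      CircuitPos n k a b c i t l x → CircuitPos n k a' b' c' i s m y →
      ¬(l = m ∧ x = y) ∧ ¬(x = 0 ∧ y = 0) ∧ ¬(x = n l ∧ y = n m)) :
    ∃ p q : G.Walk (P k i) (P k i), p.IsEulerian ∧ q.IsEulerian ∧ Avoiding G p q := by
  obtain ⟨p, hpE, hpl, hp⟩ := h.exists_circuit hi hd
  obtain ⟨q, hqE, hql, hq⟩ := h.exists_circuit hi hd'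
  have hsum := (sum_eq_of_nodup n hd).symm.trans (sum_eq_of_nodup n hd')
  refine ⟨p, q.reverse, hpE, fun e he => by simpa using hqE e he, fun t ht htl => ?_⟩
  rw [Walk.getVert_reverse]
  obtain ⟨l, x, hx, ex⟩ := hp t (by omega)
  obtain ⟨m, y, hy, ey⟩ := hq (q.length - t) (by omega)
  have := hne _ _ _ _ _ _ ht (by omega) (by omega) hx hy
  have hok := hodd k
  have hoa := hodd a
  have hob := hodd b
  have hoc := hodd c
  have hoa' := hodd a'
  have hob' := hodd b'
  have hoc' := hodd c'
  rw [ex, ey]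
  have hx' : x ≤ n l ∧ (x + t + i) % 2 = 0 := by
    rcases hx with ⟨rfl, _⟩ | ⟨rfl, _⟩ | ⟨rfl, _⟩ | ⟨rfl, _⟩ | ⟨rfl, _⟩ <;> omega
  have hy' : y ≤ n m ∧ (y + (q.length - t) + i) % 2 = 0 := by
    rcases hy with ⟨rfl, _⟩ | ⟨rfl, _⟩ | ⟨rfl, _⟩ | ⟨rfl, _⟩ | ⟨rfl, _⟩ <;> omega
  refine ⟨fun e => ?_, fun e => ?_⟩
  · have := h.inj _ _ _ _ hx'.1 hy'.1 e
    tauto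
  · have := h.odd_of_adj hodd hx'.1 hy'.1 e
    omega

/-- Avoiding circuits from an internal vertex of a path of length at least 3 which is closer to `u`
than to `v`. -/
theorem exists_avoiding_of_internal [DecidableEq V] (h : IsTheta G u v n P)
    (hodd : ∀ k, n k % 2 = 1) {k a b c : Fin 4} {i : ℕ} (hd : [k, a, b, c].Nodup) (ha : n a = 1)
    (hb : 3 ≤ n b) (hc : 3 ≤ n c) (hk : n k ≤ n b + n c + 1) (h₀ : 0 < i) (hi : 2 * i < n k) :
    ∃ p q : G.Walk (P k i) (P k i), p.IsEulerian ∧ q.IsEulerian ∧ Avoiding G p q := by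
  have hok := hodd k
  have hob := hodd b
  have hoc := hodd c
  obtain ⟨hka, hkb, hkc, hab, hac, hbc⟩ :
      k ≠ a ∧ k ≠ b ∧ k ≠ c ∧ a ≠ b ∧ a ≠ c ∧ b ≠ c := by simpa [and_assoc] using hd
  by_cases hik : n k = 2 * i + 1
  · refine h.exists_avoiding hodd (by omega) hd (a' := a) (b' := c) (c' := b)
      (by simp [*, Ne.symm]) ?_
    rintro t s l m x y ht hs hts (⟨rfl, hx⟩ | ⟨rfl, hx⟩ | ⟨rfl, hx⟩ | ⟨rfl, hx⟩ | ⟨rfl, hx⟩)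
      (⟨rfl, hy⟩ | ⟨rfl, hy⟩ | ⟨rfl, hy⟩ | ⟨rfl, hy⟩ | ⟨rfl, hy⟩) <;>
      simp only [hka, hka.symm, hkb, hkb.symm, hkc, hkc.symm, hab, hab.symm, hac, hac.symm, hbc,
        hbc.symm, false_and, true_and, not_false_eq_true] <;>
      clear hka hkb hkc hab hac hbc <;>
      omega
  · refine h.exists_avoiding hodd (by omega) (a := b) (b := c) (c := a) (a' := c) (b' := b)
      (c' := a) (by simp [*, Ne.symm]) (by simp [*, Ne.symm]) ?_
    rintro t s l m x y ht hs hts (⟨rfl, hx⟩ | ⟨rfl, hx⟩ | ⟨rfl, hx⟩ | ⟨rfl, hx⟩ | ⟨rfl, hx⟩)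
      (⟨rfl, hy⟩ | ⟨rfl, hy⟩ | ⟨rfl, hy⟩ | ⟨rfl, hy⟩ | ⟨rfl, hy⟩) <;>
      simp only [hka, hka.symm, hkb, hkb.symm, hkc, hkc.symm, hab, hab.symm, hac, hac.symm, hbc,
        hbc.symm, false_and, true_and, not_false_eq_true] <;>
      clear hka hkb hkc hab hac hbc <;>
      omega

/-- Avoiding circuits from `u`. -/
theorem exists_avoiding_of_end [DecidableEq V] (h : IsTheta G u v n P)
    (hodd : ∀ k, n k % 2 = 1) {k a b c : Fin 4} (hd : [k, a, b, c].Nodup) (hk : n k = 1)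
    (ha : 3 ≤ n a) (hnab : n a ≤ n b) (hnbc : n b ≤ n c) :
    ∃ p q : G.Walk u u, p.IsEulerian ∧ q.IsEulerian ∧ Avoiding G p q := by
  have hoa := hodd a
  have hob := hodd b
  have hoc := hodd c
  obtain ⟨hka, hkb, hkc, hab, hac, hbc⟩ :
      k ≠ a ∧ k ≠ b ∧ k ≠ c ∧ a ≠ b ∧ a ≠ c ∧ b ≠ c := by simpa [and_assoc] using hd
  rw [← h.map_zero k]
  refine h.exists_avoiding hodd (by omega) hd (a' := a) (b' := c) (c' := b)
    (by simp [*, Ne.symm]) ?_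
  rintro t s l m x y ht hs hts (⟨rfl, hx⟩ | ⟨rfl, hx⟩ | ⟨rfl, hx⟩ | ⟨rfl, hx⟩ | ⟨rfl, hx⟩)
    (⟨rfl, hy⟩ | ⟨rfl, hy⟩ | ⟨rfl, hy⟩ | ⟨rfl, hy⟩ | ⟨rfl, hy⟩) <;>
    simp only [hka, hka.symm, hkb, hkb.symm, hkc, hkc.symm, hab, hab.symm, hac, hac.symm, hbc,
      hbc.symm, false_and, true_and, not_false_eq_true] <;>
    clear hka hkb hkc hab hac hbc <;>
    omega

/-- A trail entering a path continues along it. -/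
theorem getVert_of_isTrail (h : IsTheta G u v n P) {k : Fin 4} {r : ℕ} (hr : n k = 2 * r)
    {x : V} (p : G.Walk (P k r) x) (hp : p.IsTrail) (hl : 0 < p.length) :
    (∀ t ≤ p.length, t ≤ r → p.getVert t = P k (r + t)) ∨
      (∀ t ≤ p.length, t ≤ r → p.getVert t = P k (r - t)) := by
  have hpos := h.pos k
  have hback : ∀ t, t + 2 ≤ p.length → p.getVert (t + 2) ≠ p.getVert t := fun t ht e => by
    have h₁ := Walk.getElem_edges (p := p) (i := t) (by rw [Walk.length_edges]; omega)
    have h₂ := Walk.getElem_edges (p := p) (i := t + 1) (by rw [Walk.length_edges]; omega)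
    rw [show t + 1 + 1 = t + 2 by omega, e, Sym2.eq_swap, ← h₁] at h₂
    have := (hp.edges_nodup.getElem_inj_iff).1 h₂
    omega
  have hadj : ∀ t, t < p.length → G.Adj (p.getVert t) (p.getVert (t + 1)) := fun t ht =>
    p.adj_getVert_succ ht
  have hone := hadj 0 hl
  rw [Walk.getVert_zero] at hone
  refine (h.eq_or_eq_of_adj (by omega) (by omega) hone).imp (fun h₁ t => ?_) (fun h₁ t => ?_)
  all_goals
    induction t using Nat.twoStepInduction with
    | zero => simp
    | one => exact fun _ _ => h₁
    | more t ih₀ ih₁ =>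
      intro hl ht
      have hstep := hadj (t + 1) (by omega)
      have hne := hback t hl
      rw [ih₁ (by omega) (by omega)] at hstep
      rw [ih₀ (by omega) (by omega)] at hne
      rcases h.eq_or_eq_of_adj (by omega) (by omega) hstep with e | e
      · first
        | exact e
        | exact absurd (e.trans (congrArg (P k) (by omega))) hne
      · first
        | exact e
        | exact absurd e hne

/-- If `u` and `v` are adjacent and some path has even length, then two Eulerian circuits from its
midpoint either start with the same edge or reach `u` and `v` at the same time. -/
theorem not_avoiding_of_midpoint [DecidableEq V] (h : IsTheta G u v n P) (huv : G.Adj u v)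
    {k : Fin 4} {r : ℕ} (hr : n k = 2 * r) (p q : G.Walk (P k r) (P k r)) (hp : p.IsEulerian)
    (hq : q.IsEulerian) : ¬ Avoiding G p q := by
  intro hav
  have hpos := h.pos k
  have hlen : ∀ w : G.Walk (P k r) (P k r), w.IsEulerian → r < w.length := fun w hw => by
    have hl : 0 < w.length := by
      rw [← Walk.length_edges, List.length_pos_iff]
      exact List.ne_nil_of_mem (hw.mem_edges_iff.2 (G.mem_edgeSet.2 huv))
    by_contra! hlt
    have e := w.getVert_length
    rcases h.getVert_of_isTrail hr w hw.isTrail hl with h' | h' <;>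
    · rw [h' _ le_rfl hlt] at e
      have := h.inj _ _ _ _ (by omega) (by omega) e
      omega
  have hpl := hlen p hp
  have hql := hlen q hq
  have h₁ := hav 1 one_pos (by omega)
  have hr' := hav r (by omega) hpl
  rcases h.getVert_of_isTrail hr p hp.isTrail (by omega) with hp' | hp' <;>
  rcases h.getVert_of_isTrail hr q hq.isTrail (by omega) with hq' | hq'
  · exact h₁.1 ((hp' 1 (by omega) (by omega)).trans (hq' 1 (by omega) (by omega)).symm)
  · rw [hp' r (by omega) le_rfl, hq' r (by omega) le_rfl, ← two_mul, ← hr, Nat.sub_self,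
      h.map_zero, h.map_length] at hr'
    exact hr'.2 huv.symm
  · rw [hp' r (by omega) le_rfl, hq' r (by omega) le_rfl, ← two_mul, ← hr, Nat.sub_self,
      h.map_zero, h.map_length] at hr'
    exact hr'.2 huv
  · exact h₁.1 ((hp' 1 (by omega) (by omega)).trans (hq' 1 (by omega) (by omega)).symm)

end IsTheta

/-- The vertices `u, f 0, …, f (k - 1), v` of a path as a function of the distance from `u`. -/
def pathVert {V : Type*} (u v : V) {k : ℕ} (f : Fin k → V) (i : ℕ) : V :=
  if h : 0 < i ∧ i - 1 < k then f ⟨i - 1, h.2⟩ else if i = 0 then u else v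

theorem pathVert_zero {V : Type*} (u v : V) {k : ℕ} (f : Fin k → V) : pathVert u v f 0 = u := by
  simp [pathVert]

theorem pathVert_last {V : Type*} (u v : V) {k : ℕ} (f : Fin k → V) :
    pathVert u v f (k + 1) = v := by
  simp [pathVert]

theorem pathVert_succ {V : Type*} (u v : V) {k : ℕ} (f : Fin k → V) (i : Fin k) :
    pathVert u v f (i + 1) = f i := by
  simp [pathVert]

theorem pathRel_iff {V : Type*} {u v : V} {k : ℕ} (hk : 0 < k) {f : Fin k → V} {x y : V} :
    pathRel u v f x y ↔ ∃ i < k + 1, x = pathVert u v f i ∧ y = pathVert u v f (i + 1) := by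
  constructor
  · rintro (⟨i, hi, rfl, rfl⟩ | ⟨i, j, hij, rfl, rfl⟩ | ⟨i, hi, rfl, rfl⟩)
    · exact ⟨i, by omega, by rw [hi, pathVert_zero], (pathVert_succ ..).symm⟩
    · exact ⟨i + 1, by omega, (pathVert_succ ..).symm, by rw [← hij, pathVert_succ]⟩
    · exact ⟨i + 1, by omega, (pathVert_succ ..).symm, by
        rw [show (i : ℕ) + 1 + 1 = k + 1 by omega, pathVert_last]⟩
  · rintro ⟨i, hi, rfl, rfl⟩
    rcases Nat.eq_zero_or_pos i with rfl | h₀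
    · exact .inl ⟨⟨0, hk⟩, rfl, pathVert_zero .., pathVert_succ u v f ⟨0, hk⟩⟩
    · obtain ⟨j, rfl⟩ : ∃ j, i = j + 1 := ⟨i - 1, by omega⟩
      rcases Nat.lt_or_ge (j + 1) k with h | h
      · exact .inr (.inl ⟨⟨j, by omega⟩, ⟨j + 1, h⟩, rfl, pathVert_succ u v f ⟨j, _⟩,
          pathVert_succ u v f ⟨j + 1, h⟩⟩)
      · obtain rfl : k = j + 1 := by omega
        exact .inr (.inr ⟨⟨j, by omega⟩, rfl, pathVert_succ u v f ⟨j, _⟩, pathVert_last ..⟩)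

/-- The numbers of edges of the four paths of `Γ(0,b,c,d)`. -/
def gammaLength (b c d : ℕ) : Fin 4 → ℕ := ![1, b + 1, c + 1, d + 1]

/-- The four paths of `Γ(0,b,c,d)`. -/
def gammaPath (b c d : ℕ) : Fin 4 → ℕ → GammaV 0 b c d :=
  ![pathVert (Sum.inl 0) (Sum.inl 1) fun i : Fin 0 => Sum.inr (Sum.inl i),
    pathVert (Sum.inl 0) (Sum.inl 1) fun i : Fin b => Sum.inr (Sum.inr (Sum.inl i)),
    pathVert (Sum.inl 0) (Sum.inl 1) fun i : Fin c => Sum.inr (Sum.inr (Sum.inr (Sum.inl i))),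
    pathVert (Sum.inl 0) (Sum.inl 1) fun i : Fin d => Sum.inr (Sum.inr (Sum.inr (Sum.inr i)))]

theorem gammaPath_inj {b c d : ℕ} (k l : Fin 4) (i j : ℕ) (hi : i ≤ gammaLength b c d k)
    (hj : j ≤ gammaLength b c d l) (e : gammaPath b c d k i = gammaPath b c d l j) :
    (k = l ∧ i = j) ∨ (i = 0 ∧ j = 0) ∨ (i = gammaLength b c d k ∧ j = gammaLength b c d l) := by
  fin_cases k <;> fin_cases l <;>
    simp [gammaLength, gammaPath, pathVert] at hi hj e ⊢ <;>
    split_ifs at e <;> simp at e <;> omega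

theorem gamma_adj_iff {b c d : ℕ} (hb : 1 ≤ b) (hc : 1 ≤ c) (hd : 1 ≤ d) {x y : GammaV 0 b c d} :
    (Gamma 0 b c d).Adj x y ↔
      ∃ k i, i < gammaLength b c d k ∧
        s(x, y) = s(gammaPath b c d k i, gammaPath b c d k (i + 1)) := by
  have hA : ∀ x y : GammaV 0 b c d, ¬ pathRel (Sum.inl 0) (Sum.inl 1)
      (fun i : Fin 0 => (Sum.inr (Sum.inl i) : GammaV 0 b c d)) x y := by
    rintro x y (⟨i, _⟩ | ⟨i, _⟩ | ⟨i, _⟩) <;> exact i.elim0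
  have hrel : ∀ x y : GammaV 0 b c d, (x = Sum.inl 0 ∧ y = Sum.inl 1 ∨
      pathRel (Sum.inl 0) (Sum.inl 1) (fun i : Fin b => Sum.inr (Sum.inr (Sum.inl i))) x y ∨
      pathRel (Sum.inl 0) (Sum.inl 1) (fun i : Fin c => Sum.inr (Sum.inr (Sum.inr (Sum.inl i))))
        x y ∨
      pathRel (Sum.inl 0) (Sum.inl 1) (fun i : Fin d => Sum.inr (Sum.inr (Sum.inr (Sum.inr i))))
        x y) ↔
      ∃ k i, i < gammaLength b c d k ∧ x = gammaPath b c d k i ∧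
        y = gammaPath b c d k (i + 1) := by
    intro x y
    rw [pathRel_iff hb, pathRel_iff hc, pathRel_iff hd]
    simp [Fin.exists_fin_succ, gammaLength, gammaPath, pathVert_zero, pathVert_last]
  have hne : ∀ k i, i < gammaLength b c d k → gammaPath b c d k i ≠ gammaPath b c d k (i + 1) :=
    fun k i hi e => by
      have := gammaPath_inj _ _ _ _ hi.le hi e
      omega
  simp only [Gamma, SimpleGraph.fromRel_adj, true_or, and_true, hA, false_or, hrel]
  constructor
  · rintro ⟨_, ⟨k, i, hi, rfl, rfl⟩ | ⟨k, i, hi, rfl, rfl⟩⟩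
    · exact ⟨k, i, hi, rfl⟩
    · exact ⟨k, i, hi, Sym2.eq_swap⟩
  · rintro ⟨k, i, hi, e⟩
    rcases Sym2.eq_iff.1 e with ⟨rfl, rfl⟩ | ⟨rfl, rfl⟩
    · exact ⟨hne k i hi, .inl ⟨k, i, hi, rfl, rfl⟩⟩
    · exact ⟨(hne k i hi).symm, .inr ⟨k, i, hi, rfl, rfl⟩⟩

theorem isTheta_gamma {b c d : ℕ} (hb : 1 ≤ b) (hc : 1 ≤ c) (hd : 1 ≤ d) :
    IsTheta (Gamma 0 b c d) (Sum.inl 0) (Sum.inl 1) (gammaLength b c d) (gammaPath b c d) where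
  pos k := by fin_cases k <;> simp [gammaLength]
  map_zero k := by fin_cases k <;> simp [gammaPath, pathVert_zero]
  map_length k := by fin_cases k <;> simp [gammaPath, gammaLength, pathVert]
  adj k i hi := (gamma_adj_iff hb hc hd).2 ⟨k, i, hi, rfl⟩
  edge x y hxy := (gamma_adj_iff hb hc hd).1 hxy
  inj := gammaPath_inj
  simple k l hkl hk := by
    fin_cases k <;> fin_cases l <;> simp [gammaLength] at hkl hk ⊢ <;> omega

theorem exists_gammaPath_eq {b c d : ℕ} (x : GammaV 0 b c d) :
    x = Sum.inl 0 ∨ x = Sum.inl 1 ∨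
      ∃ k i, k ≠ 0 ∧ 0 < i ∧ i < gammaLength b c d k ∧ x = gammaPath b c d k i := by
  rcases x with x | i | i | i | i
  · fin_cases x <;> simp
  · exact i.elim0
  · exact .inr (.inr ⟨1, i + 1, by decide, by omega, Nat.succ_lt_succ i.2,
      by simp [gammaPath, pathVert_succ]⟩)
  · exact .inr (.inr ⟨2, i + 1, by decide, by omega, Nat.succ_lt_succ i.2,
      by simp [gammaPath, pathVert_succ]⟩)
  · exact .inr (.inr ⟨3, i + 1, by decide, by omega, Nat.succ_lt_succ i.2,
      by simp [gammaPath, pathVert_succ]⟩)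

/-- For `Γ(0,b,c,d)` with `1 ≤ b ≤ c ≤ d < b + c + 3`, the graph is doubly
Eulerian if and only if it is bipartite, equivalently `b`, `c`, `d` are all
even. -/
theorem Gamma_a0_doublyEulerian_iff_bipartite
    (b c d : ℕ) (hb : 1 ≤ b) (hbc : b ≤ c) (hcd : c ≤ d) (hd : d < b + c + 3) :
    DoublyEulerian (Gamma 0 b c d) ↔ (Even b ∧ Even c ∧ Even d) := by
  have h := isTheta_gamma hb (hb.trans hbc) (hb.trans (hbc.trans hcd))
  constructor
  · intro hG
    have huv : (Gamma 0 b c d).Adj (Sum.inl 0) (Sum.inl 1) := h.adj 0 0 one_pos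
    have hodd : ∀ k r, gammaLength b c d k ≠ 2 * r := fun k r hr => by
      obtain ⟨p, q, hp, hq, hav⟩ := hG (gammaPath b c d k r)
      exact h.not_avoiding_of_midpoint huv hr p q hp hq hav
    have h₁ := hodd 1
    have h₂ := hodd 2
    have h₃ := hodd 3
    simp only [gammaLength, Matrix.cons_val] at h₁ h₂ h₃
    refine ⟨?_, ?_, ?_⟩ <;> by_contra hne <;> rw [Nat.not_even_iff_odd] at hne <;>
      obtain ⟨r, rfl⟩ := hne
    · exact h₁ (r + 1) (by omega)
    · exact h₂ (r + 1) (by omega)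
    · exact h₃ (r + 1) (by omega)
  · rintro ⟨hbe, hce, hde⟩ x
    rw [Nat.even_iff] at hbe hce hde
    have hodd : ∀ k, gammaLength b c d k % 2 = 1 := fun k => by
      fin_cases k <;> simp [gammaLength] <;> omega
    have h₀ : gammaLength b c d 0 = 1 := rfl
    have h₁ : gammaLength b c d 1 = b + 1 := rfl
    have h₂ : gammaLength b c d 2 = c + 1 := rfl
    have h₃ : gammaLength b c d 3 = d + 1 := rfl
    rcases exists_gammaPath_eq x with rfl | rfl | ⟨k, i, hk, hi₀, hi, rfl⟩
    · exact h.exists_avoiding_of_end hodd (k := 0) (a := 1) (b := 2) (c := 3) (by decide) h₀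
        (by omega) (by omega) (by omega)
    · exact h.reflect.exists_avoiding_of_end hodd (k := 0) (a := 1) (b := 2) (c := 3) (by decide)
        h₀ (by omega) (by omega) (by omega)
    · obtain ⟨l, m, hd', hl, hm, hle⟩ : ∃ l m : Fin 4, [k, 0, l, m].Nodup ∧
          3 ≤ gammaLength b c d l ∧ 3 ≤ gammaLength b c d m ∧
          gammaLength b c d k ≤ gammaLength b c d l + gammaLength b c d m + 1 := by
        have hk' : k = 1 ∨ k = 2 ∨ k = 3 := by omega
        rcases hk' with rfl | rfl | rfl
        · exact ⟨2, 3, by decide, by omega, by omega, by omega⟩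
        · exact ⟨1, 3, by decide, by omega, by omega, by omega⟩
        · exact ⟨1, 2, by decide, by omega, by omega, by omega⟩
      rcases Nat.lt_or_ge (2 * i) (gammaLength b c d k) with hlt | hge
      · exact h.exists_avoiding_of_internal hodd hd' h₀ hl hm hle hi₀ hlt
      · have hok := hodd k
        have := h.reflect.exists_avoiding_of_internal hodd hd' h₀ hl hm hle
          (i := gammaLength b c d k - i) (by omega) (by omega)
        rwa [Nat.sub_sub_self hi.le] at this
end

section
/- Let G be an Eulerian graph of order n with maximum degree Δ ≤ n − 2. Then av(G) ≤ n − Δ − 1. -/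
open SimpleGraph

/-- A family of Eulerian circuits from a common start vertex is *mutually avoiding*
if any two distinct members are avoiding. -/
def MutuallyAvoiding {V : Type*} [DecidableEq V] (G : SimpleGraph V) {u : V} {k : ℕ}
    (c : Fin k → G.Walk u u) : Prop :=
  (∀ i, (c i).IsEulerian) ∧ ∀ i j, i ≠ j → Avoiding G (c i) (c j)


/-- The edges of a walk through `x`, counted by the visits of `x` at their two ends. -/
theorem SimpleGraph.Walk.countP_mem_edges {V : Type*} [DecidableEq V] {G : SimpleGraph V}
    {u w : V} (p : G.Walk u w) (x : V) :
    p.edges.countP (x ∈ ·) =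
      ∑ i ∈ Finset.range p.length,
        ((if p.getVert i = x then 1 else 0) + (if p.getVert (i + 1) = x then 1 else 0)) := by
  induction p with
  | nil => simp
  | @cons a b c h p ih =>
    rw [Walk.edges_cons, List.countP_cons, ih, Walk.length_cons, Finset.sum_range_succ']
    simp only [Walk.getVert_cons_succ, Walk.getVert_zero, zero_add]
    have hne := h.ne
    congr 1
    by_cases h1 : a = x
    · subst h1
      simp [hne.symm]
    · by_cases h2 : b = x
      · subst h2
        simp [hne]
      · simp [h1, h2, Ne.symm h1, Ne.symm h2]

/-- An Eulerian circuit visits each vertex half as often as its degree. -/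
theorem SimpleGraph.Walk.IsEulerian.two_mul_card_visits {V : Type*} [Fintype V] [DecidableEq V]
    {G : SimpleGraph V} [DecidableRel G.Adj] {u : V} {p : G.Walk u u} (hp : p.IsEulerian) (x : V) :
    2 * ((Finset.range p.length).filter (fun i => p.getVert i = x)).card = G.degree x := by
  have hdeg : G.degree x = p.edges.countP (x ∈ ·) := by
    rw [← G.card_incidenceFinset_eq_degree, G.incidenceFinset_eq_filter,
      List.countP_eq_length_filter, ← List.toFinset_card_of_nodup (hp.isTrail.edges_nodup.filter _)]
    congr 1
    ext e
    simp [hp.mem_edges_iff]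
  have hshift : ∑ i ∈ Finset.range p.length, (if p.getVert (i + 1) = x then 1 else 0) =
      ∑ i ∈ Finset.range p.length, (if p.getVert i = x then 1 else 0) := by
    have h1 := Finset.sum_range_succ (fun i => if p.getVert i = x then 1 else 0) p.length
    have h2 := Finset.sum_range_succ' (fun i => if p.getVert i = x then 1 else 0) p.length
    simp only [Walk.getVert_length, Walk.getVert_zero] at h1 h2
    omega
  rw [hdeg, p.countP_mem_edges, Finset.sum_add_distrib, hshift, Finset.card_filter, two_mul]

/-- All Eulerian walks have the same length. -/
theorem SimpleGraph.Walk.IsEulerian.length_eq {V : Type*} [DecidableEq V]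
    {G : SimpleGraph V} {u v a b : V} {p : G.Walk u v} {q : G.Walk a b}
    (hp : p.IsEulerian) (hq : q.IsEulerian) : p.length = q.length := by
  rw [← p.length_edges, ← q.length_edges,
    ← List.toFinset_card_of_nodup hp.isTrail.edges_nodup,
    ← List.toFinset_card_of_nodup hq.isTrail.edges_nodup]
  congr 1
  ext e
  simp [hp.mem_edges_iff, hq.mem_edges_iff]

/-- While one of `k` mutually avoiding Eulerian circuits is at `v`, the others are at
non-neighbours of `v`. -/
theorem MutuallyAvoiding.mul_degree_add_two_le {V : Type*} [Fintype V] [DecidableEq V]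
    {G : SimpleGraph V} [DecidableRel G.Adj] {u v : V} {k : ℕ} {c : Fin k → G.Walk u u}
    (hc : MutuallyAvoiding G c) (j : Fin k) (hv : 0 < G.degree v) (huv : u ≠ v)
    (hadj : ¬ G.Adj v u) :
    (k - 1) * G.degree v + 2 ≤ ∑ w with w ≠ v ∧ ¬ G.Adj v w, G.degree w := by
  obtain ⟨hE, hA⟩ := hc
  set m := (c j).length
  have hlen (i : Fin k) : (c i).length = m := (hE i).length_eq (hE j)
  let A (i : Fin k) := (Finset.range m).filter (fun t => (c i).getVert t = v)
  have hAcard (i : Fin k) : 2 * (A i).card = G.degree v := by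
    simpa only [A, hlen i] using (hE i).two_mul_card_visits v
  have hpos (i : Fin k) {t : ℕ} (ht : (c i).getVert t = v) : 0 < t := by
    rcases Nat.eq_zero_or_pos t with rfl | h
    · exact absurd ((c i).getVert_zero.symm.trans ht) huv
    · exact h
  have hm0 : 0 < m := by
    have h1 := hAcard j
    obtain ⟨t, ht⟩ := Finset.card_pos.mp (show 0 < (A j).card by omega)
    simp only [A, Finset.mem_filter, Finset.mem_range] at ht
    omega
  let N : Finset V := {w | w ≠ v ∧ ¬ G.Adj v w}
  let B := (Finset.range m).filter (fun t => (c j).getVert t ∈ N)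
  have hB : 2 * B.card = ∑ w ∈ N, G.degree w := by
    rw [Finset.card_eq_sum_card_fiberwise (s := B) (f := (c j).getVert) (t := N)
      (fun t ht => (Finset.mem_filter.mp ht).2), Finset.mul_sum]
    refine Finset.sum_congr rfl fun w hw => ?_
    rw [← (hE j).two_mul_card_visits w, Finset.filter_filter]
    congr 2
    ext t
    simp only [Finset.mem_filter]
    constructor
    · exact fun h => ⟨h.1, h.2.2⟩
    · exact fun h => ⟨h.1, h.2 ▸ hw, h.2⟩
  have hsub : (Finset.univ.erase j).biUnion A ⊆ B.erase 0 := by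
    intro t ht
    simp only [A, Finset.mem_biUnion, Finset.mem_erase, Finset.mem_univ, and_true,
      Finset.mem_filter, Finset.mem_range] at ht
    obtain ⟨i, hij, htm, htv⟩ := ht
    have h0 := hpos i htv
    have hav := hA i j hij t h0 (by rw [hlen]; exact htm)
    rw [htv] at hav
    simp only [B, N, Finset.mem_erase, Finset.mem_filter, Finset.mem_range, Finset.mem_univ,
      true_and]
    exact ⟨h0.ne', htm, hav.1.symm, hav.2⟩
  have hdisj : ((Finset.univ.erase j : Finset (Fin k)) : Set (Fin k)).PairwiseDisjoint A := by
    intro i _ i' _ hii'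
    refine Finset.disjoint_left.mpr fun t ht ht' => ?_
    simp only [A, Finset.mem_filter, Finset.mem_range] at ht ht'
    exact (hA i i' hii' t (hpos i ht.2) (by rw [hlen]; exact ht.1)).1 (ht.2.trans ht'.2.symm)
  have h0B : 0 ∈ B := by
    simp [B, N, hm0, huv, hadj]
  have hle := Finset.card_le_card hsub
  have hBpos := Finset.card_pos.mpr ⟨0, h0B⟩
  rw [Finset.card_biUnion hdisj, Finset.card_erase_of_mem h0B] at hle
  have hsum : 2 * ∑ i ∈ Finset.univ.erase j, (A i).card = (k - 1) * G.degree v := by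
    rw [Finset.mul_sum, Finset.sum_congr rfl (fun i _ => hAcard i), Finset.sum_const,
      Finset.card_erase_of_mem (Finset.mem_univ j), Finset.card_univ, Fintype.card_fin, smul_eq_mul]
  change _ ≤ ∑ w ∈ N, G.degree w
  omega

/-- For an Eulerian graph `G` of order `n` with maximum degree `Δ ≤ n - 2`, the
avoidance index is at most `n - Δ - 1`: if from every vertex there exist `k`
mutually avoiding Eulerian circuits, then `k ≤ n - Δ - 1`. -/
theorem avoidance_le_order_sub_maxDegree
    {V : Type*} [Fintype V] [DecidableEq V] [Nonempty V]
    (G : SimpleGraph V) [DecidableRel G.Adj]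
    (hconn : G.Connected) (heven : ∀ v : V, Even (G.degree v))
    (hΔ : G.maxDegree + 2 ≤ Fintype.card V) (k : ℕ)
    (h : ∀ u : V, ∃ c : Fin k → G.Walk u u, MutuallyAvoiding G c) :
    k ≤ Fintype.card V - G.maxDegree - 1 := by
  obtain ⟨v, hv⟩ := G.exists_maximal_degree_vertex
  let N : Finset V := {w | w ≠ v ∧ ¬ G.Adj v w}
  have hN : N.card + G.maxDegree + 1 = Fintype.card V := by
    have hNeq : N = (insert v (G.neighborFinset v))ᶜ := by
      ext w
      simp [N]
    have h1 := Finset.card_add_card_compl (insert v (G.neighborFinset v))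
    rw [← hNeq, Finset.card_insert_of_notMem (by simp), G.card_neighborFinset_eq_degree, ← hv] at h1
    omega
  obtain ⟨u, hu⟩ := Finset.card_pos.mp (show 0 < N.card by omega)
  simp only [N, Finset.mem_filter, Finset.mem_univ, true_and] at hu
  have : Nontrivial V := ⟨u, v, hu.1⟩
  have hdeg : 0 < G.degree v := hconn.preconnected.degree_pos_of_nontrivial v
  obtain ⟨c, hc⟩ := h u
  rcases Nat.eq_zero_or_pos k with rfl | hk
  · exact Nat.zero_le _
  have hmain := hc.mul_degree_add_two_le ⟨0, hk⟩ hdeg hu.1 hu.2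
  have hS : ∑ w ∈ N, G.degree w ≤ N.card * G.degree v := by
    rw [← hv]
    exact Finset.sum_le_card_nsmul _ _ _ fun w _ => G.degree_le_maxDegree w
  have hlt : (k - 1) * G.degree v < N.card * G.degree v :=
    lt_of_lt_of_le (Nat.lt_of_lt_of_le (Nat.lt_add_of_pos_right two_pos) hmain) hS
  have := Nat.lt_of_mul_lt_mul_right hlt
  omega
end

section
/- The complete bipartite graph K_{2s,2s} (s ≥ 1) has avoidance index exactly 2s − 1. -/
open SimpleGraph

/-- A sequence of consecutively adjacent vertices traces out a walk. -/
theorem exists_walk_getVert_eq {V : Type*} {G : SimpleGraph V} (m : ℕ) (f : ℕ → V)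
    (hf : ∀ i, G.Adj (f i) (f (i + 1))) :
    ∃ p : G.Walk (f 0) (f m), p.length = m ∧ (∀ i ≤ m, p.getVert i = f i) ∧
      ∀ i < m, s(f i, f (i + 1)) ∈ p.edges := by
  induction m generalizing f with
  | zero => exact ⟨.nil, by simp⟩
  | succ m ih =>
    obtain ⟨p, hl, hv, he⟩ := ih (fun i => f (i + 1)) (fun i => hf (i + 1))
    refine ⟨.cons (hf 0) p, by simp [hl], fun i hi => ?_, fun i hi => ?_⟩
    · cases i with
      | zero => simp
      | succ i => simpa using hv i (by omega)
    · cases i with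
      | zero => simp
      | succ i => simpa using Or.inr (he i (by omega))

section CompleteBipartite

variable {α β : Type*} [Fintype α] [Fintype β] [DecidableEq α] [DecidableEq β]

/-- A walk in a complete bipartite graph using all edges takes at least as many distinct
edges as there are pairs of vertices from the two parts. -/
theorem card_mul_card_le_card_toFinset_edges {u v : α ⊕ β}
    (p : (completeBipartiteGraph α β).Walk u v)
    (h : ∀ a b, s(Sum.inl a, Sum.inr b) ∈ p.edges) :
    Fintype.card α * Fintype.card β ≤ p.edges.toFinset.card := by
  rw [← Fintype.card_prod, ← Finset.card_univ]
  refine Finset.card_le_card_of_injOn (fun x => s(Sum.inl x.1, Sum.inr x.2))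
    (fun x _ => by simpa using h x.1 x.2) ?_
  rintro ⟨a, b⟩ - ⟨a', b'⟩ - hab
  simpa using hab

/-- A walk in a complete bipartite graph that uses all edges and is no longer than their
number is Eulerian. -/
theorem isEulerian_of_length_le {u v : α ⊕ β} (p : (completeBipartiteGraph α β).Walk u v)
    (hl : p.length ≤ Fintype.card α * Fintype.card β)
    (h : ∀ a b, s(Sum.inl a, Sum.inr b) ∈ p.edges) : p.IsEulerian := by
  have hc := card_mul_card_le_card_toFinset_edges p h
  have hd : p.edges.dedup = p.edges := by
    refine (List.dedup_sublist _).eq_of_length_le ?_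
    rw [← List.card_toFinset, Walk.length_edges]
    omega
  refine (Walk.isEulerian_iff p).2 ⟨⟨List.dedup_eq_self.1 hd⟩, fun e he => ?_⟩
  induction e with
  | _ x y =>
    rcases x with a | b <;> rcases y with a' | b' <;> simp at he
    · exact h a b'
    · exact Sym2.eq_swap ▸ h a' b

theorem card_mul_card_le_length_of_isEulerian {u v : α ⊕ β}
    {p : (completeBipartiteGraph α β).Walk u v} (hp : p.IsEulerian) :
    Fintype.card α * Fintype.card β ≤ p.length := by
  refine (card_mul_card_le_card_toFinset_edges p fun a b => hp.mem_edges_iff.2 (by simp)).trans ?_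
  exact (List.toFinset_card_le _).trans_eq p.length_edges

end CompleteBipartite

/-- Mutually avoiding Eulerian circuits are carried along by graph automorphisms. -/
theorem MutuallyAvoiding.map_iso {V : Type*} [DecidableEq V] {G : SimpleGraph V} {u : V} {k : ℕ}
    {c : Fin k → G.Walk u u} (hc : MutuallyAvoiding G c) (e : G ≃g G) :
    MutuallyAvoiding G fun i => (c i).map e.toHom := by
  refine ⟨fun i x hx => ?_, fun i j hij t ht htl => ?_⟩
  · obtain ⟨y, rfl, hy⟩ : ∃ y, Sym2.map e y = x ∧ y ∈ G.edgeSet := by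
      induction x with
      | _ a b => exact ⟨s(e.symm a, e.symm b), by simp, e.symm.map_adj_iff.2 hx⟩
    rw [Walk.edges_map]
    exact (List.count_map_of_injective _ _ (Sym2.map.injective e.injective) y).trans (hc.1 i y hy)
  · obtain ⟨h₁, h₂⟩ := hc.2 i j hij t ht (by simpa using htl)
    simp only [Walk.getVert_map]
    exact ⟨fun h => h₁ (e.injective h), fun h => h₂ (e.map_adj_iff.1 h)⟩

theorem exists_iso_completeBipartiteGraph_apply_inl {α : Type*} [DecidableEq α] (a : α)
    (u : α ⊕ α) :
    ∃ e : completeBipartiteGraph α α ≃g completeBipartiteGraph α α, e (Sum.inl a) = u := by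
  rcases u with b | b
  · refine ⟨⟨Equiv.sumCongr (Equiv.swap a b) (Equiv.refl α), ?_⟩,
      by simp [-Equiv.Perm.sumCongr_swap_refl]⟩
    rintro (x | x) (y | y) <;> simp [-Equiv.Perm.sumCongr_swap_refl]
  · refine ⟨⟨(Equiv.sumCongr (Equiv.swap a b) (Equiv.refl α)).trans (Equiv.sumComm α α), ?_⟩,
      by simp [-Equiv.Perm.sumCongr_swap_refl]⟩
    rintro (x | x) (y | y) <;> simp [-Equiv.Perm.sumCongr_swap_refl]

/-- Sequences `X i`, `Y i` of vertices in the two parts, read alternately, give mutually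
avoiding Eulerian circuits. -/
theorem exists_mutuallyAvoiding_of_seq {n k N : ℕ} {u : Fin n} (X Y : Fin k → ℕ → Fin n)
    (hN : 2 * N = n * n) (hstart : ∀ i, X i 0 = u) (hend : ∀ i, X i N = u)
    (hcover : ∀ i a b, ∃ t < N, Y i t = b ∧ (X i t = a ∨ X i (t + 1) = a))
    (hX : ∀ i j, i ≠ j → ∀ t, 0 < t → t < N → X i t ≠ X j t)
    (hY : ∀ i j, i ≠ j → ∀ t, Y i t ≠ Y j t) :
    ∃ c : Fin k → (completeBipartiteGraph (Fin n) (Fin n)).Walk (Sum.inl u) (Sum.inl u),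
      MutuallyAvoiding (completeBipartiteGraph (Fin n) (Fin n)) c := by
  let f : Fin k → ℕ → Fin n ⊕ Fin n := fun i t =>
    if t % 2 = 0 then Sum.inl (X i (t / 2)) else Sum.inr (Y i (t / 2))
  have hfe (i t) : f i (2 * t) = Sum.inl (X i t) := by simp [f]
  have hfo (i t) : f i (2 * t + 1) = Sum.inr (Y i t) := by
    have : (2 * t + 1) / 2 = t := by omega
    simp [f, this]
  have hadj (i t) : (completeBipartiteGraph (Fin n) (Fin n)).Adj (f i t) (f i (t + 1)) := by
    obtain ⟨r, rfl | rfl⟩ := Nat.even_or_odd' t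
    · simp [hfe, hfo]
    · rw [hfo, show 2 * r + 1 + 1 = 2 * (r + 1) by ring, hfe]
      simp
  choose p hl hv he using fun i => exists_walk_getVert_eq (2 * N) (f i) (hadj i)
  have h₀ (i) : f i 0 = Sum.inl u := by simpa [hstart] using hfe i 0
  have h₁ (i) : f i (2 * N) = Sum.inl u := by rw [hfe, hend]
  refine ⟨fun i => (p i).copy (h₀ i) (h₁ i), fun i => ?_, fun i j hij t ht htl => ?_⟩
  · refine isEulerian_of_length_le _ (by simp [hl, hN]) fun a b => ?_
    rw [Walk.edges_copy]
    obtain ⟨t, ht, rfl, rfl | rfl⟩ := hcover i a b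
    · simpa [hfe, hfo] using he i (2 * t) (by omega)
    · have hmem := he i (2 * t + 1) (by omega)
      have hnext : f i (2 * t + 1 + 1) = Sum.inl (X i (t + 1)) := hfe i (t + 1)
      rwa [hfo, hnext, Sym2.eq_swap] at hmem
  · rw [Walk.length_copy, hl] at htl
    simp only [Walk.getVert_copy]
    rw [hv i t htl.le, hv j t htl.le]
    obtain ⟨r, rfl | rfl⟩ := Nat.even_or_odd' t
    · simpa [hfe] using hX i j hij r (by omega) (by omega)
    · simpa [hfo] using hY i j hij r

/-- There is no family of `n ≥ 2` mutually avoiding Eulerian circuits in `K_{n,n}`: after two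
steps one of them would be back at the start vertex, along a repeated edge. -/
theorem not_exists_mutuallyAvoiding {n : ℕ} (hn : 2 ≤ n) (u : Fin n)
    (c : Fin n → (completeBipartiteGraph (Fin n) (Fin n)).Walk (Sum.inl u) (Sum.inl u)) :
    ¬ MutuallyAvoiding (completeBipartiteGraph (Fin n) (Fin n)) c := by
  rintro ⟨heul, hav⟩
  have hlen (i) : 4 ≤ (c i).length := by
    have := card_mul_card_le_length_of_isEulerian (heul i)
    simp only [Fintype.card_fin] at this
    nlinarith
  have hadj₀ (i) := (c i).adj_getVert_succ (i := 0) (by have := hlen i; omega)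
  have hadj₁ (i) := (c i).adj_getVert_succ (i := 1) (by have := hlen i; omega)
  simp only [Walk.getVert_zero, zero_add, Nat.reduceAdd] at hadj₀ hadj₁
  have hex (i) : ∃ a, (c i).getVert 2 = Sum.inl a := by
    have h₀ := hadj₀ i
    have h₁ := hadj₁ i
    revert h₀ h₁
    rcases (c i).getVert 1 with a | a <;> rcases (c i).getVert 2 with b | b <;> simp
  choose g hg using hex
  have hinj : Function.Injective g := by
    intro i j hij
    by_contra hne
    exact (hav i j hne 2 (by omega) (by have := hlen i; omega)).1 (by rw [hg, hg, hij])
  obtain ⟨i, hi⟩ := (Finite.injective_iff_surjective.1 hinj) u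
  have hback : (c i).getVert 2 = (c i).getVert 0 := by rw [hg, hi, Walk.getVert_zero]
  have hl := hlen i
  have hnodup := (heul i).isTrail.edges_nodup
  revert hl hnodup hback
  rcases c i with _ | ⟨h, _ | ⟨h', q⟩⟩
  · simp
  · simp
  · intro hback
    simp only [Walk.getVert_zero, Walk.getVert_cons_succ] at hback
    subst hback
    simp [Sym2.eq_swap]

/-- For `s ≥ 1` there is a Latin square of order `2 * s` with identity `0` and zero diagonal. -/
theorem exists_unipotent_latinSquare (s : ℕ) [NeZero (2 * s)] :
    ∃ L : Fin (2 * s) → Fin (2 * s) → Fin (2 * s),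
      (∀ k, Function.Injective (L k)) ∧ (∀ x, Function.Injective fun k => L k x) ∧
      (∀ x, L 0 x = x) ∧ (∀ k, L k 0 = k) ∧ ∀ k, L k k = 0 := by
  have hs : 2 * s ≠ 0 := NeZero.ne _
  have : NeZero (2 * s - 1) := ⟨by omega⟩
  have htwo : (s : ZMod (2 * s - 1)) * 2 = 1 := by
    have h : ((2 * s - 1 + 1 : ℕ) : ZMod (2 * s - 1)) = 1 := by
      rw [Nat.cast_add, ZMod.natCast_self]; simp
    rw [show 2 * s - 1 + 1 = s * 2 by omega] at h
    exact_mod_cast h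
  generalize hr : (s : ZMod (2 * s - 1)) = r at htwo
  let M : Option (ZMod (2 * s - 1)) → Option (ZMod (2 * s - 1)) → Option (ZMod (2 * s - 1))
    | none, y => y
    | some x, none => some x
    | some x, some y => if x = y then none else some (r * (x + y))
  have hcomm (x y) : M x y = M y x := by
    rcases x with _ | x <;> rcases y with _ | y <;> simp [M, eq_comm, add_comm]
  have hinj (x) : Function.Injective (M x) := by
    rcases x with _ | x
    · exact fun y z h => h
    · rintro (_ | y) (_ | z) h <;> simp only [M] at h <;> grind
  obtain ⟨e, he⟩ : ∃ e : Option (ZMod (2 * s - 1)) ≃ Fin (2 * s), e none = 0 := by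
    let e₀ : Option (ZMod (2 * s - 1)) ≃ Fin (2 * s) :=
      Fintype.equivFinOfCardEq (by rw [Fintype.card_option, ZMod.card]; omega)
    exact ⟨e₀.trans (Equiv.swap (e₀ none) 0), by simp⟩
  have he' : e.symm 0 = none := by rw [← he, e.symm_apply_apply]
  have hM (x) : M x none = x := by rw [hcomm]
  have hdiag (x) : M x x = none := by rcases x with _ | x <;> simp [M]
  refine ⟨fun x y => e (M (e.symm x) (e.symm y)), fun x => ?_, fun y => ?_, ?_, ?_, ?_⟩
  · exact e.injective.comp ((hinj _).comp e.symm.injective)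
  · simp only [hcomm _ (e.symm y)]
    exact e.injective.comp ((hinj _).comp e.symm.injective)
  · simp [he', M]
  · simp [he', hM]
  · simp [hdiag, he]

/-- The time axis `1, 2, …` is cut into blocks of length `2 * s + 1`, numbered from `1`. -/
def zigzagBlock (s t : ℕ) : ℕ := (t - 1) / (2 * s + 1) + 1

/-- The row occupied at time `t` by the zig-zag numbering of the `2 * s × 2 * s` square. -/
def zigzagRow (s t : ℕ) : ℕ :=
  if t = 0 then 0 else (zigzagBlock s t + (t - 1) % (2 * s + 1)) % (2 * s)

/-- The columns of the square are grouped into pairs. Block `j < s` of the zig-zag runs through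
the pair `j`, and ends in the pair `0`; block `s` stays in the pair `0`. -/
def zigzagPair (s t : ℕ) : ℕ :=
  if t ≠ 0 ∧ (t - 1) % (2 * s + 1) < 2 * s ∧ zigzagBlock s t < s then zigzagBlock s t else 0

/-- The column occupied at time `t` by the zig-zag numbering of the `2 * s × 2 * s` square. -/
def zigzagCol (s t : ℕ) : ℕ := 2 * zigzagPair s t + t % 2

/-- The times at which the `k`-th circuit exchanges the rows `0` and `k`: the start, the end, and
one block in between. -/
def IsExchangeTime (s k t : ℕ) : Prop :=
  t = 0 ∨ t = 2 * s ^ 2 ∨ zigzagBlock s t = min k s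

instance (s k t : ℕ) : Decidable (IsExchangeTime s k t) := by
  unfold IsExchangeTime; infer_instance

section Zigzag

variable {s q r : ℕ}

theorem zigzagRow_lt {t : ℕ} (hs : 1 ≤ s) : zigzagRow s t < 2 * s := by
  unfold zigzagRow
  split_ifs
  · omega
  · exact Nat.mod_lt _ (by omega)

theorem zigzagCol_lt {t : ℕ} (hs : 1 ≤ s) : zigzagCol s t < 2 * s := by
  unfold zigzagCol zigzagPair
  split_ifs <;> omega

theorem zigzagBlock_add (hr : r ≤ 2 * s) : zigzagBlock s (1 + (2 * s + 1) * q + r) = q + 1 := by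
  rw [zigzagBlock, show 1 + (2 * s + 1) * q + r - 1 = r + (2 * s + 1) * q by omega,
    Nat.add_mul_div_left _ _ (by omega), Nat.div_eq_of_lt (by omega), zero_add]

theorem add_sub_one_mod (hr : r ≤ 2 * s) :
    (1 + (2 * s + 1) * q + r - 1) % (2 * s + 1) = r := by
  rw [show 1 + (2 * s + 1) * q + r - 1 = r + (2 * s + 1) * q by omega,
    Nat.add_mul_mod_self_left, Nat.mod_eq_of_lt (by omega)]

theorem zigzagRow_add (hr : r ≤ 2 * s) :
    zigzagRow s (1 + (2 * s + 1) * q + r) = (q + 1 + r) % (2 * s) := by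
  rw [zigzagRow, if_neg (by omega), zigzagBlock_add hr, add_sub_one_mod hr]

theorem zigzagPair_add (hr : r ≤ 2 * s) :
    zigzagPair s (1 + (2 * s + 1) * q + r) = if r < 2 * s ∧ q + 1 < s then q + 1 else 0 := by
  simp only [zigzagPair, zigzagBlock_add hr, add_sub_one_mod hr]
  congr 1
  simp

theorem zigzagPair_pred : zigzagPair s ((2 * s + 1) * q) = 0 := by
  rcases q with _ | q
  · simp [zigzagPair]
  · rw [show (2 * s + 1) * (q + 1) = 1 + (2 * s + 1) * q + 2 * s by ring, zigzagPair_add le_rfl]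
    simp

theorem block_start_add_lt (hq : q + 1 < s) (hr : r ≤ 2 * s) :
    1 + (2 * s + 1) * q + r < 2 * s ^ 2 := by
  obtain ⟨d, rfl⟩ := Nat.exists_eq_add_of_lt hq
  nlinarith

theorem last_block_add (hq : q + 1 = s) : 1 + (2 * s + 1) * q + s = 2 * s ^ 2 := by
  subst hq; ring

theorem zigzagRow_last (hs : 1 ≤ s) : zigzagRow s (2 * s ^ 2) = 0 := by
  obtain ⟨q, rfl⟩ := Nat.exists_eq_add_of_le' hs
  rw [← last_block_add rfl, zigzagRow_add (by omega), ← two_mul, Nat.mod_self]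

/-- In the last block the zig-zag does not visit row `0` before the end. -/
theorem zigzagRow_ne_zero {t : ℕ} (hs : 1 ≤ s) (ht : 0 < t) (htl : t < 2 * s ^ 2)
    (hb : zigzagBlock s t = s) : zigzagRow s t ≠ 0 := by
  have hdiv := Nat.div_add_mod (t - 1) (2 * s + 1)
  have hmod := Nat.mod_lt (t - 1) (show 2 * s + 1 > 0 by omega)
  unfold zigzagBlock at hb
  generalize (t - 1) / (2 * s + 1) = q at *
  generalize (t - 1) % (2 * s + 1) = r at *
  obtain rfl : t = 1 + (2 * s + 1) * q + r := by omega
  have := last_block_add hb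
  rw [zigzagRow_add (by omega), Nat.mod_eq_of_lt (by omega)]
  omega

/-- After exchanging the rows `0` and `k` at the exchange times, the zig-zag still
visits every cell of the square. -/
theorem exists_zigzag_visit {k a b : ℕ} (hs : 1 ≤ s) (hk₀ : k ≠ 0) (hk : k < 2 * s)
    (ha : a < 2 * s) (hb : b < 2 * s) :
    ∃ t ≤ 2 * s ^ 2, (if IsExchangeTime s k t then Equiv.swap 0 k (zigzagRow s t)
      else zigzagRow s t) = a ∧
      (t < 2 * s ^ 2 ∧ zigzagCol s t = b ∨ 0 < t ∧ zigzagCol s (t - 1) = b) := by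
  have hcol {t : ℕ} (h₁ : zigzagPair s t = b / 2) (h₂ : t % 2 = b % 2) : zigzagCol s t = b := by
    unfold zigzagCol; omega
  have hrow {q r : ℕ} (hr : r ≤ 2 * s) (hlt : 1 + (2 * s + 1) * q + r < 2 * s ^ 2) :
      (if IsExchangeTime s k (1 + (2 * s + 1) * q + r) then
        Equiv.swap 0 k (zigzagRow s (1 + (2 * s + 1) * q + r))
        else zigzagRow s (1 + (2 * s + 1) * q + r)) =
      if q + 1 = min k s then Equiv.swap 0 k ((q + 1 + r) % (2 * s))
        else (q + 1 + r) % (2 * s) := by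
    have : IsExchangeTime s k (1 + (2 * s + 1) * q + r) ↔ q + 1 = min k s := by
      unfold IsExchangeTime
      rw [zigzagBlock_add hr]
      omega
    simp only [this, zigzagRow_add hr]
  /- Within block `q + 1` the row `q + 1` is visited at the first and at the last time. -/
  have hends {q : ℕ} (hq : q + 1 < s) (hqa : (if q + 1 = k then 0 else q + 1) = a)
      (hb' : b / 2 = 0 ∨ b / 2 = q + 1) :
      ∃ t ≤ 2 * s ^ 2, (if IsExchangeTime s k t then Equiv.swap 0 k (zigzagRow s t)
        else zigzagRow s t) = a ∧
        (t < 2 * s ^ 2 ∧ zigzagCol s t = b ∨ 0 < t ∧ zigzagCol s (t - 1) = b) := by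
    have hmod₀ : (q + 1 + 0) % (2 * s) = q + 1 := Nat.mod_eq_of_lt (by omega)
    have hmod₁ : (q + 1 + 2 * s) % (2 * s) = q + 1 := by
      rw [Nat.add_mod_right]; exact hmod₀
    have hlt₀ := block_start_add_lt hq (Nat.zero_le (2 * s))
    have hlt₁ := block_start_add_lt hq (le_refl (2 * s))
    have hval : (if q + 1 = min k s then Equiv.swap 0 k (q + 1) else q + 1) = a := by
      simp only [← hqa, show q + 1 = min k s ↔ q + 1 = k by omega]
      split_ifs with h
      · rw [h, Equiv.swap_apply_right]
      · rfl
    have hp₀ := zigzagPair_add (s := s) (q := q) (r := 0) (by omega)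
    have hp₁ := zigzagPair_add (s := s) (q := q) (r := 2 * s) le_rfl
    have hp₂ := zigzagPair_add (s := s) (q := q) (r := 2 * s - 1) (by omega)
    have hp₃ := zigzagPair_pred (s := s) (q := q)
    rw [if_pos (by omega)] at hp₀ hp₂
    rw [if_neg (by omega)] at hp₁
    have hrow₀ := hrow (Nat.zero_le _) hlt₀
    have hrow₁ := hrow le_rfl hlt₁
    rw [hmod₀, hval] at hrow₀
    rw [hmod₁, hval] at hrow₁
    rcases hb' with hb' | hb'
    · by_cases hpar : (1 + (2 * s + 1) * q + 2 * s) % 2 = b % 2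
      · exact ⟨_, hlt₁.le, hrow₁, .inl ⟨hlt₁, hcol (by omega) hpar⟩⟩
      · refine ⟨_, hlt₀.le, hrow₀, .inr ⟨by omega, hcol ?_ (by omega)⟩⟩
        rw [show 1 + (2 * s + 1) * q + 0 - 1 = (2 * s + 1) * q by omega]
        omega
    · by_cases hpar : (1 + (2 * s + 1) * q + 0) % 2 = b % 2
      · exact ⟨_, hlt₀.le, hrow₀, .inl ⟨hlt₀, hcol (by omega) hpar⟩⟩
      · refine ⟨_, hlt₁.le, hrow₁, .inr ⟨by omega, hcol ?_ (by omega)⟩⟩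
        rw [show 1 + (2 * s + 1) * q + 2 * s - 1 = 1 + (2 * s + 1) * q + (2 * s - 1) by omega]
        omega
  have hmid {t : ℕ} (ht : 0 < t) (htl : t < 2 * s ^ 2) (h₁ : zigzagPair s t = b / 2)
      (h₂ : zigzagPair s (t - 1) = b / 2) :
      t < 2 * s ^ 2 ∧ zigzagCol s t = b ∨ 0 < t ∧ zigzagCol s (t - 1) = b := by
    by_cases hpar : t % 2 = b % 2
    · exact .inl ⟨htl, hcol h₁ hpar⟩
    · exact .inr ⟨ht, hcol h₂ (by omega)⟩
  rcases Nat.eq_zero_or_pos (b / 2) with hb₀ | hb₀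
  · obtain rfl | hak := eq_or_ne a k
    · obtain ⟨q, hq⟩ := Nat.exists_eq_add_of_le' hs
      have hlast := last_block_add hq.symm
      obtain hb₁ | hb₁ : b = 0 ∨ b = 1 := by omega
      · refine ⟨0, by omega, by simp [IsExchangeTime, zigzagRow], .inl ⟨by positivity, ?_⟩⟩
        exact hcol (by simp [zigzagPair, hb₀]) (by omega)
      · refine ⟨2 * s ^ 2, le_rfl, by simp [IsExchangeTime, zigzagRow_last hs],
          .inr ⟨by omega, hcol ?_ (by omega)⟩⟩
        rw [hb₀, ← hlast, show 1 + (2 * s + 1) * q + s - 1 = 1 + (2 * s + 1) * q + (s - 1) by omega,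
          zigzagPair_add (by omega), if_neg (by omega)]
    · /- the row seen before the exchange -/
      obtain ⟨a', ha'₀, ha', haa'⟩ : ∃ a', a' ≠ 0 ∧ a' < 2 * s ∧
          (if a' = k then 0 else a') = a := by
        by_cases h : a = 0
        · exact ⟨k, hk₀, hk, by simp [h]⟩
        · exact ⟨a, h, ha, by simp [hak]⟩
      by_cases hlt : a' < s
      · obtain ⟨q, rfl⟩ := Nat.exists_eq_succ_of_ne_zero ha'₀
        exact hends hlt haa' (.inl hb₀)
      · obtain ⟨q, hq⟩ := Nat.exists_eq_add_of_le' hs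
        have hlast := last_block_add hq.symm
        have htl : 1 + (2 * s + 1) * q + (a' - s) < 2 * s ^ 2 := by omega
        refine ⟨_, htl.le, ?_, hmid (by omega) htl ?_ ?_⟩
        · rw [hrow (by omega) htl, Nat.mod_eq_of_lt (by omega),
            show q + 1 + (a' - s) = a' by omega, ← haa']
          by_cases h : a' = k
          · rw [if_pos (by omega), if_pos h, h, Equiv.swap_apply_right]
          · rw [if_neg h, Equiv.swap_apply_of_ne_of_ne ha'₀ h, ite_self]
        · rw [zigzagPair_add (by omega), if_neg (by omega), hb₀]
        · rcases Nat.eq_zero_or_pos (a' - s) with h | h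
          · rw [h, show 1 + (2 * s + 1) * q + 0 - 1 = (2 * s + 1) * q by omega, zigzagPair_pred,
              hb₀]
          · rw [show 1 + (2 * s + 1) * q + (a' - s) - 1 = 1 + (2 * s + 1) * q + (a' - s - 1) by
              omega, zigzagPair_add (by omega), if_neg (by omega), hb₀]
  · obtain ⟨q, hq⟩ := Nat.exists_eq_add_of_le' hb₀
    have hqs : q + 1 < s := by omega
    obtain ⟨a', ha', haa'⟩ : ∃ a' < 2 * s,
        (if q + 1 = min k s then Equiv.swap 0 k a' else a') = a := by
      by_cases h : q + 1 = min k s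
      · refine ⟨Equiv.swap 0 k a, ?_, by simp [h]⟩
        rw [Equiv.swap_apply_def]
        split_ifs <;> omega
      · exact ⟨a, ha, by simp [h]⟩
    by_cases haq : a' = q + 1
    · refine hends hqs ?_ (.inr hq)
      simp only [← haa', haq, show q + 1 = min k s ↔ q + 1 = k by omega]
      split_ifs with h
      · rw [h, Equiv.swap_apply_right]
      · rfl
    · obtain ⟨r, hr₀, hr, hra⟩ : ∃ r, 0 < r ∧ r < 2 * s ∧ (q + 1 + r) % (2 * s) = a' := by
        by_cases h : q + 1 < a'
        · exact ⟨a' - (q + 1), by omega, by omega, by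
            rw [Nat.add_sub_cancel' h.le, Nat.mod_eq_of_lt ha']⟩
        · exact ⟨a' + 2 * s - (q + 1), by omega, by omega, by
            rw [Nat.add_sub_cancel' (by omega), Nat.add_mod_right, Nat.mod_eq_of_lt ha']⟩
      have htl := block_start_add_lt hqs hr.le
      refine ⟨_, htl.le, by rw [hrow hr.le htl, hra, haa'], hmid (by omega) htl ?_ ?_⟩
      · rw [zigzagPair_add hr.le, if_pos ⟨hr, hqs⟩, hq]
      · rw [show 1 + (2 * s + 1) * q + r - 1 = 1 + (2 * s + 1) * q + (r - 1) by omega,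
          zigzagPair_add (by omega), if_pos (by omega), hq]

end Zigzag

/-- In a Latin square with identity `0` and zero diagonal, let the rows `k ≠ l` possibly have
their argument `x` moved by the transposition of `0` and `k`, respectively of `0` and `l`. The
resulting entries differ, unless both rows are changed and `x = 0`. -/
theorem latinSquare_swap_ne {α : Type*} [DecidableEq α] [Zero α] {L : α → α → α}
    (hcol : ∀ x, Function.Injective fun k => L k x) (hzero : ∀ x, L 0 x = x)
    (hid : ∀ k, L k 0 = k) (hdiag : ∀ k, L k k = 0) {k l x : α} (hk : k ≠ 0) (hl : l ≠ 0)
    (hkl : k ≠ l) {P Q : Prop} [Decidable P] [Decidable Q] (hx : P → Q → x ≠ 0) :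
    L k (if P then Equiv.swap 0 k x else x) ≠ L l (if Q then Equiv.swap 0 l x else x) := by
  have hne (x) {i j : α} (hij : i ≠ j) : L i x ≠ L j x := fun h => hij (hcol x h)
  simp only [Equiv.swap_apply_def]
  have := hne x hkl
  have := hne k hl
  have := hne l hk
  grind

/-- The complete bipartite graph `K_{2s,2s}` (`s ≥ 1`) has avoidance index
exactly `2s - 1`: from every vertex there exist `2s - 1` mutually avoiding
Eulerian circuits, but it is not the case that from every vertex there exist
`2s` such circuits. -/
theorem completeBipartite_avoidanceIndex (s : ℕ) (hs : 1 ≤ s) :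
    (∀ u : Fin (2 * s) ⊕ Fin (2 * s),
      ∃ c : Fin (2 * s - 1) → (completeBipartiteGraph (Fin (2 * s)) (Fin (2 * s))).Walk u u,
        MutuallyAvoiding (completeBipartiteGraph (Fin (2 * s)) (Fin (2 * s))) c) ∧
    ¬ (∀ u : Fin (2 * s) ⊕ Fin (2 * s),
      ∃ c : Fin (2 * s) → (completeBipartiteGraph (Fin (2 * s)) (Fin (2 * s))).Walk u u,
        MutuallyAvoiding (completeBipartiteGraph (Fin (2 * s)) (Fin (2 * s))) c) := by
  refine ⟨fun u => ?_, fun h => ?_⟩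
  · have : NeZero (2 * s) := ⟨by omega⟩
    obtain ⟨L, hLrow, hLcol, hLzero, hLid, hLdiag⟩ := exists_unipotent_latinSquare s
    obtain ⟨e, rfl⟩ := exists_iso_completeBipartiteGraph_apply_inl (0 : Fin (2 * s)) u
    suffices ∃ c : Fin (2 * s - 1) → (completeBipartiteGraph (Fin (2 * s)) (Fin (2 * s))).Walk
        (Sum.inl 0) (Sum.inl 0), MutuallyAvoiding _ c by
      obtain ⟨c, hc⟩ := this
      exact ⟨_, hc.map_iso e⟩
    let κ (i : Fin (2 * s - 1)) : Fin (2 * s) := ⟨i + 1, by omega⟩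
    have hκ₀ (i) : κ i ≠ 0 := by simp [κ, Fin.ext_iff]
    have hκ {i j} (hij : i ≠ j) : κ i ≠ κ j := by simpa [κ, Fin.ext_iff] using hij
    let row (t : ℕ) : Fin (2 * s) := ⟨zigzagRow s t, zigzagRow_lt hs⟩
    let col (t : ℕ) : Fin (2 * s) := ⟨zigzagCol s t, zigzagCol_lt hs⟩
    let row' (k : Fin (2 * s)) (t : ℕ) : Fin (2 * s) :=
      if IsExchangeTime s k t then Equiv.swap 0 k (row t) else row t
    refine exists_mutuallyAvoiding_of_seq (N := 2 * s ^ 2) (fun i t => L (κ i) (row' (κ i) t))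
      (fun i t => col t + κ i) (by ring) (fun i => ?_) (fun i => ?_) (fun i a b => ?_)
      (fun i j hij t ht htl => ?_) (fun i j hij t h => hκ hij (add_left_cancel h))
    · have : row 0 = 0 := by simp [row, zigzagRow]
      simp [row', IsExchangeTime, this, hLdiag]
    · have : row (2 * s ^ 2) = 0 := by simp [row, zigzagRow_last hs]
      simp [row', IsExchangeTime, this, hLdiag]
    · obtain ⟨a, rfl⟩ := (Finite.injective_iff_surjective.1 (hLrow (κ i))) a
      obtain ⟨t, htN, hta, htb⟩ := exists_zigzag_visit hs (k := κ i) (by simp [κ]) (κ i).2 a.2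
        (b - κ i).2
      have ha : row' (κ i) t = a := by
        rw [Fin.ext_iff, ← hta]
        simp only [row', row, Equiv.swap_apply_def, Fin.ext_iff, Fin.val_zero]
        split_ifs <;> rfl
      rcases htb with ⟨ht, htb⟩ | ⟨ht, htb⟩
      · exact ⟨t, ht, by rw [show col t = b - κ i from Fin.ext htb, sub_add_cancel],
          .inl (by rw [ha])⟩
      · refine ⟨t - 1, by omega, ?_, .inr (by rw [Nat.sub_add_cancel ht, ha])⟩
        rw [show col (t - 1) = b - κ i from Fin.ext htb, sub_add_cancel]
    · refine latinSquare_swap_ne hLcol hLzero hLid hLdiag (hκ₀ i) (hκ₀ j) (hκ hij)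
        fun hi hj hrow => ?_
      have hij' : (κ i : ℕ) ≠ κ j := fun h => hκ hij (Fin.ext h)
      unfold IsExchangeTime at hi hj
      exact zigzagRow_ne_zero hs ht htl (by omega) (by simpa [row] using congrArg Fin.val hrow)
  · obtain ⟨c, hc⟩ := h (Sum.inl ⟨0, by omega⟩)
    exact not_exists_mutuallyAvoiding (by omega) _ c hc
end

section
/- For every n ≥ 11, there exists a connected 4-regular simple graph of order n which is not doubly Eulerian. -/
open SimpleGraph

/-- A walk cannot leave a set whose only way out is `u` without visiting `u`. -/
theorem SimpleGraph.Walk.getVert_mem_of_forall_ne {V : Type*} {G : SimpleGraph V} {u a b : V}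
    (p : G.Walk a b) {S : Set V}
    (hS : ∀ x ∈ S, ∀ y, G.Adj x y → y = u ∨ y ∈ S) {k l : ℕ} (hl : l ≤ p.length)
    (hne : ∀ i, k < i → i < l → p.getVert i ≠ u) (hk : p.getVert (k + 1) ∈ S) :
    ∀ i, k < i → i < l → p.getVert i ∈ S := by
  intro i hki
  induction i, hki using Nat.le_induction with
  | base => exact fun _ => hk
  | succ i hki ih =>
    intro hil
    exact (hS _ (ih (by omega)) _ (p.adj_getVert_succ (by omega))).resolve_left
      (hne _ (by omega) hil)

section EulerianCircuits

variable {V : Type*} [DecidableEq V] {G : SimpleGraph V} {u : V}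

/-- An Eulerian circuit of a 4-regular graph visits every vertex exactly twice, its start
being counted once for its two ends. -/
theorem SimpleGraph.Walk.IsEulerian.card_visits {p : G.Walk u u} (hp : p.IsEulerian)
    (hG : ∀ v : V, (G.neighborSet v).ncard = 4) (x : V) :
    ((Finset.range p.length).filter fun i => p.getVert i = x).card = 2 := by
  set E : ℕ → Sym2 V := fun i => s(p.getVert i, p.getVert (i + 1)) with hE
  have hget : ∀ i (hi : i < p.length), p.edges[i]'(by simpa using hi) = E i := fun i hi =>
    p.getElem_edges _
  have hinj : Set.InjOn E (Finset.range p.length) := by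
    intro i hi j hj hij
    simp only [Finset.coe_range, Set.mem_Iio] at hi hj
    rw [← hget i hi, ← hget j hj] at hij
    exact (List.Nodup.getElem_inj_iff hp.isTrail.edges_nodup).1 hij
  have himage : (((Finset.range p.length).filter fun i => x ∈ E i).image E : Set (Sym2 V))
      = G.incidenceSet x := by
    ext e
    simp only [Finset.coe_image, Finset.coe_filter, Finset.mem_range, Set.mem_image,
      Set.mem_ofPred_eq, incidenceSet]
    rw [← hp.mem_edges_iff]
    constructor
    · rintro ⟨i, ⟨hi, hx⟩, rfl⟩
      refine ⟨?_, hx⟩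
      rw [← hget i hi]
      exact List.getElem_mem _
    · rintro ⟨he, hx⟩
      obtain ⟨i, hi, rfl⟩ := List.getElem_of_mem he
      have hi' : i < p.length := by simpa using hi
      rw [hget i hi'] at hx ⊢
      exact ⟨i, ⟨hi', hx⟩, rfl⟩
  have hfour : ((Finset.range p.length).filter fun i => x ∈ E i).card = 4 := by
    rw [← Finset.card_image_of_injOn (hinj.mono (Finset.coe_subset.2 (Finset.filter_subset _ _))),
      ← Set.ncard_coe_finset, himage,
      ← hG x]
    exact Nat.card_congr (G.incidenceSetEquivNeighborSet x)
  have hsplit : ((Finset.range p.length).filter fun i => x ∈ E i).card =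
      ((Finset.range p.length).filter fun i => p.getVert i = x).card +
      ((Finset.range p.length).filter fun i => p.getVert (i + 1) = x).card := by
    rw [← Finset.card_union_of_disjoint, ← Finset.filter_or]
    · congr 1
      ext i
      simp [hE, eq_comm]
    · rw [Finset.disjoint_filter]
      intro i hi h₁ h₂
      exact (p.adj_getVert_succ (Finset.mem_range.1 hi)).ne (h₁.trans h₂.symm)
  have hshift : ((Finset.range p.length).filter fun i => p.getVert i = x).card =
      ((Finset.range p.length).filter fun i => p.getVert (i + 1) = x).card := by
    have h₁ := Finset.sum_range_succ (fun i => if p.getVert i = x then 1 else 0) p.length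
    have h₂ := Finset.sum_range_succ' (fun i => if p.getVert i = x then 1 else 0) p.length
    rw [Walk.getVert_length] at h₁
    rw [Walk.getVert_zero] at h₂
    rw [Finset.card_filter, Finset.card_filter]
    omega
  omega

theorem SimpleGraph.Walk.IsEulerian.card_visits_finset {p : G.Walk u u} (hp : p.IsEulerian)
    (hG : ∀ v : V, (G.neighborSet v).ncard = 4) (S : Finset V) :
    ((Finset.range p.length).filter fun i => p.getVert i ∈ S).card = 2 * S.card := by
  rw [Finset.card_eq_sum_card_fiberwise (f := p.getVert) (t := S) (by intro i hi; simp_all),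
    Finset.sum_congr rfl (g := fun _ => 2), Finset.sum_const, smul_eq_mul, mul_comm]
  intro x hx
  rw [Finset.filter_filter, ← hp.card_visits hG x]
  congr 1
  ext i
  simp only [Finset.mem_filter, Finset.mem_range]
  grind

/-- An Eulerian circuit of a 4-regular graph started at a cut vertex `u` separating `A` from `B`
exhausts one side, returns to `u`, and then exhausts the other side. -/
theorem SimpleGraph.Walk.IsEulerian.exists_return {p : G.Walk u u} (hp : p.IsEulerian)
    (hG : ∀ v : V, (G.neighborSet v).ncard = 4) {A B : Finset V} (hA : A.Nonempty)
    (hB : B.Nonempty) (huA : u ∉ A) (huB : u ∉ B) (hAB : Disjoint A B)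
    (hcover : ∀ x, x = u ∨ x ∈ A ∨ x ∈ B) (hadj : ∀ x ∈ A, ∀ y ∈ B, ¬ G.Adj x y) :
    ∃ t, p.getVert t = u ∧ p.length = 2 * A.card + 2 * B.card + 2 ∧
      ((t = 2 * A.card + 1 ∧ p.getVert (t + 1) ∈ B) ∨
        (t = 2 * B.card + 1 ∧ p.getVert (t - 1) ∈ B)) := by
  have hSA : ∀ x ∈ (A : Set V), ∀ y, G.Adj x y → y = u ∨ y ∈ (A : Set V) := by
    intro x hx y hxy
    have := hadj x hx y
    have := hcover y
    simp only [Finset.mem_coe]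
    tauto
  have hSB : ∀ x ∈ (B : Set V), ∀ y, G.Adj x y → y = u ∨ y ∈ (B : Set V) := by
    intro x hx y hxy
    have := fun hy => hadj y hy x hx hxy.symm
    have := hcover y
    simp only [Finset.mem_coe]
    tauto
  have hvisit := hp.card_visits hG u
  have hlen : 0 < p.length := by
    rw [Nat.pos_iff_ne_zero]
    intro h
    simp [h] at hvisit
  obtain ⟨t, ht0, htL, htu, htonly⟩ : ∃ t, 0 < t ∧ t < p.length ∧ p.getVert t = u ∧
      ∀ i, 0 < i → i < p.length → p.getVert i = u → i = t := by
    obtain ⟨a, b, hab, hset⟩ := Finset.card_eq_two.1 hvisit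
    have key : ∀ i, (i < p.length ∧ p.getVert i = u) ↔ (i = a ∨ i = b) := fun i => by
      simpa using Finset.ext_iff.1 hset i
    have ha := (key a).2 (.inl rfl)
    have hb := (key b).2 (.inr rfl)
    rcases (key 0).1 ⟨hlen, p.getVert_zero⟩ with rfl | rfl
    · exact ⟨b, by omega, hb.1, hb.2, fun i h₁ h₂ h₃ => by have := (key i).1 ⟨h₂, h₃⟩; omega⟩
    · exact ⟨a, by omega, ha.1, ha.2, fun i h₁ h₂ h₃ => by have := (key i).1 ⟨h₂, h₃⟩; omega⟩
  have hne₁ : ∀ i, 0 < i → i < t → p.getVert i ≠ u := fun i h₁ h₂ h₃ => by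
    have := htonly i h₁ (by omega) h₃
    omega
  have hne₂ : ∀ i, t < i → i < p.length → p.getVert i ≠ u := fun i h₁ h₂ h₃ => by
    have := htonly i (by omega) h₂ h₃
    omega
  have hloop : ∀ i < p.length, p.getVert i = u → p.getVert (i + 1) ≠ u := fun i hi h₁ h₂ =>
    (p.adj_getVert_succ hi).ne (h₁.trans h₂.symm)
  have ht1 : 1 < t := by
    by_contra h
    obtain rfl : t = 1 := by omega
    exact hloop 0 hlen p.getVert_zero htu
  have htL1 : t + 1 < p.length := by
    by_contra h
    refine hloop t htL htu ?_
    rw [show t + 1 = p.length by omega, p.getVert_length]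
  have hfirst : ∀ {S : Finset V}, (∀ x ∈ (S : Set V), ∀ y, G.Adj x y → y = u ∨ y ∈ (S : Set V)) →
      p.getVert 1 ∈ S → ∀ i, 0 < i → i < t → p.getVert i ∈ S := fun hS h1 =>
    p.getVert_mem_of_forall_ne hS htL.le hne₁ h1
  have hsecond : ∀ {S : Finset V}, (∀ x ∈ (S : Set V), ∀ y, G.Adj x y → y = u ∨ y ∈ (S : Set V)) →
      p.getVert (t + 1) ∈ S → ∀ i, t < i → i < p.length → p.getVert i ∈ S := fun hS h1 =>
    p.getVert_mem_of_forall_ne hS le_rfl hne₂ h1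
  have hpart : ∀ {S T : Finset V}, Disjoint S T → u ∉ S → u ∉ T →
      (∀ i, 0 < i → i < t → p.getVert i ∈ S) →
      (∀ i, t < i → i < p.length → p.getVert i ∈ T) →
      t = 2 * S.card + 1 ∧ p.length = 2 * S.card + 2 * T.card + 2 := by
    intro S T hST huS huT h₁ h₂
    have hdisj : ∀ x ∈ S, x ∉ T := fun x hx => Finset.disjoint_left.1 hST hx
    have e₁ : ((Finset.range p.length).filter fun i => p.getVert i ∈ S) = Finset.Ioo 0 t := by
      ext i
      simp only [Finset.mem_filter, Finset.mem_range, Finset.mem_Ioo]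
      refine ⟨fun ⟨hi, hS⟩ => ⟨?_, ?_⟩, fun ⟨h, h'⟩ => ⟨by omega, h₁ i h h'⟩⟩
      · rcases Nat.eq_zero_or_pos i with rfl | h
        · simp [huS] at hS
        · exact h
      · by_contra h
        rcases (not_lt.1 h).eq_or_lt with rfl | h
        · exact huS (htu ▸ hS)
        · exact hdisj _ hS (h₂ i h hi)
    have e₂ : ((Finset.range p.length).filter fun i => p.getVert i ∈ T) =
        Finset.Ioo t p.length := by
      ext i
      simp only [Finset.mem_filter, Finset.mem_range, Finset.mem_Ioo]
      refine ⟨fun ⟨hi, hT⟩ => ⟨?_, hi⟩, fun ⟨h, h'⟩ => ⟨h', h₂ i h h'⟩⟩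
      by_contra h
      rcases (not_lt.1 h).eq_or_lt with rfl | h
      · exact huT (htu ▸ hT)
      · rcases Nat.eq_zero_or_pos i with rfl | h0
        · simp [huT] at hT
        · exact hdisj _ (h₁ i h0 h) hT
    have c₁ := hp.card_visits_finset hG S
    have c₂ := hp.card_visits_finset hG T
    rw [e₁, Nat.card_Ioo] at c₁
    rw [e₂, Nat.card_Ioo] at c₂
    omega
  have hmissed : ∀ {S T : Finset V}, Disjoint S T → T.Nonempty → u ∉ T →
      (∀ i, 0 < i → i < t → p.getVert i ∈ S) →
      (∀ i, t < i → i < p.length → p.getVert i ∈ S) → False := by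
    intro S T hST hT huT h₁ h₂
    have c := hp.card_visits_finset hG T
    have hpos := hT.card_pos
    obtain ⟨i, hi⟩ := Finset.card_pos.1 (c ▸ by omega :
      0 < ((Finset.range p.length).filter fun i => p.getVert i ∈ T).card)
    simp only [Finset.mem_filter, Finset.mem_range] at hi
    rcases Nat.eq_zero_or_pos i with rfl | h0
    · simp [huT] at hi
    · rcases lt_trichotomy i t with h | rfl | h
      · exact Finset.disjoint_left.1 hST (h₁ i h0 h) hi.2
      · exact huT (htu ▸ hi.2)
      · exact Finset.disjoint_left.1 hST (h₂ i h hi.1) hi.2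
  refine ⟨t, htu, ?_⟩
  rcases (hcover (p.getVert 1)).resolve_left (hne₁ 1 one_pos ht1) with h₁ | h₁ <;>
    rcases (hcover (p.getVert (t + 1))).resolve_left (hne₂ _ (by omega) htL1) with h₂ | h₂
  · exact (hmissed hAB hB huB (hfirst hSA h₁) (hsecond hSA h₂)).elim
  · have h := hpart hAB huA huB (hfirst hSA h₁) (hsecond hSB h₂)
    exact ⟨h.2, .inl ⟨h.1, h₂⟩⟩
  · have h := hpart hAB.symm huB huA (hfirst hSB h₁) (hsecond hSA h₂)
    exact ⟨by omega, .inr ⟨h.1, hfirst hSB h₁ _ (by omega) (by omega)⟩⟩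
  · exact (hmissed hAB.symm hA huA (hfirst hSB h₁) (hsecond hSB h₂)).elim

/-- A 4-regular graph with a cut vertex `u` separating `A` from `B` is not doubly Eulerian when
`A` and `B` have equal size, or `B` has one more vertex and the neighbors of `u` in `B` form a
clique. -/
theorem not_doublyEulerian_of_cut_vertex (hG : ∀ v : V, (G.neighborSet v).ncard = 4)
    {A B : Finset V} (hA : A.Nonempty) (hB : B.Nonempty) (huA : u ∉ A) (huB : u ∉ B)
    (hAB : Disjoint A B) (hcover : ∀ x, x = u ∨ x ∈ A ∨ x ∈ B)
    (hadj : ∀ x ∈ A, ∀ y ∈ B, ¬ G.Adj x y)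
    (hcard : B.card = A.card ∨ B.card = A.card + 1 ∧
      ∀ x ∈ B, ∀ y ∈ B, G.Adj u x → G.Adj u y → x = y ∨ G.Adj x y) :
    ¬ DoublyEulerian G := by
  intro h
  obtain ⟨p, q, hp, hq, hpq⟩ := h u
  obtain ⟨t, htu, hpL, ht⟩ := hp.exists_return hG hA hB huA huB hAB hcover hadj
  obtain ⟨r, hru, hqL, hr⟩ := hq.exists_return hG hA hB huA huB hAB hcover hadj
  have hBpos := hB.card_pos
  have hApos := hA.card_pos
  by_cases htr : t = r
  · exact (hpq t (by omega) (by omega)).1 (htu.trans (htr ▸ hru.symm))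
  have hafter : ∀ w : G.Walk u u, ∀ i < w.length, w.getVert i = u →
      G.Adj u (w.getVert (i + 1)) := fun w i hi hw => by
    simpa only [hw] using w.adj_getVert_succ hi
  have hbefore : ∀ w : G.Walk u u, ∀ i ≤ w.length, 0 < i → w.getVert i = u →
      G.Adj u (w.getVert (i - 1)) := fun w i hi h0 hw => by
    have := w.adj_getVert_succ (i := i - 1) (by omega)
    rw [Nat.sub_add_cancel h0, hw] at this
    exact this.symm
  rcases hcard with hcard | ⟨hcard, hclique⟩
  · omega
  rcases ht with ⟨ht, hpB⟩ | ⟨ht, hpB⟩ <;> rcases hr with ⟨hr, hqB⟩ | ⟨hr, hqB⟩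
  · omega
  · have hi : r - 1 = t + 1 := by omega
    have := hclique _ hpB _ hqB (hafter p t (by omega) htu)
      (hbefore q r (by omega) (by omega) hru)
    rw [hi] at this
    have := hpq (t + 1) (by omega) (by omega)
    tauto
  · have hi : t - 1 = r + 1 := by omega
    have := hclique _ hpB _ hqB (hbefore p t (by omega) (by omega) htu)
      (hafter q r (by omega) hru)
    rw [hi] at this
    have := hpq (r + 1) (by omega) (by omega)
    tauto
  · omega

end EulerianCircuits

/-- The pairs `i < j` joined in the graph on `{0, …, 2 * s + e}` which consists of squares of paths
on `[0, s)` and `(s, 2 * s + e]`, with two edges joining the ends of each, and of the cut vertex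
`s` joined to the endpoints of both paths. -/
def TwoPadsLT (s e i j : ℕ) : Prop :=
  (j < s ∧ (j = i + 1 ∨ j = i + 2 ∨ (i = 0 ∧ j = s - 2) ∨ (i = 1 ∧ j = s - 1))) ∨
  (j = s ∧ (i = 0 ∨ i = s - 1)) ∨
  (i = s ∧ (j = s + 1 ∨ j = 2 * s + e)) ∨
  (s < i ∧ (j = i + 1 ∨ j = i + 2 ∨ (i = s + 1 ∧ j = 2 * s + 2 * e - 1) ∨
    (i = s + 2 ∧ j = 2 * s)))

/-- The graph on `n` vertices whose adjacency is the symmetrization of `TwoPadsLT`. -/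
def twoPads (n s e : ℕ) : SimpleGraph (Fin n) where
  Adj i j := (i < j ∧ TwoPadsLT s e i j) ∨ (j < i ∧ TwoPadsLT s e j i)
  symm := ⟨fun _ _ h => h.symm⟩
  loopless := ⟨fun i h => by simp at h⟩

theorem twoPads_adj {n s e : ℕ} {i j : Fin n} : (twoPads n s e).Adj i j ↔
    ((i : ℕ) < j ∧ TwoPadsLT s e i j) ∨ ((j : ℕ) < i ∧ TwoPadsLT s e j i) := Iff.rfl

theorem twoPadsLT_succ {s e : ℕ} (i : ℕ) : TwoPadsLT s e i (i + 1) := by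
  unfold TwoPadsLT
  rcases lt_trichotomy (i + 1) s with h | h | h
  · exact .inl ⟨h, .inl rfl⟩
  · exact .inr (.inl ⟨h, by omega⟩)
  · rcases (show s ≤ i by omega).eq_or_lt with rfl | h'
    · exact .inr (.inr (.inl ⟨rfl, .inl rfl⟩))
    · exact .inr (.inr (.inr ⟨h', .inl rfl⟩))

theorem twoPads_connected {n s e : ℕ} (hn : n = 2 * s + 1 + e) : (twoPads n s e).Connected := by
  obtain ⟨m, rfl⟩ : ∃ m, n = m + 1 := ⟨2 * s + e, by omega⟩
  refine (pathGraph_connected m).mono fun i j h => ?_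
  rw [pathGraph_adj] at h
  rw [twoPads_adj]
  rcases h with h | h
  · exact .inl ⟨by omega, h ▸ twoPadsLT_succ _⟩
  · exact .inr ⟨by omega, h ▸ twoPadsLT_succ _⟩

theorem ncard_neighborSet_eq_four {n : ℕ} {G : SimpleGraph (Fin n)} {v : Fin n} (a b c d : ℕ)
    (hab : a < b) (hbc : b < c) (hcd : c < d) (hd : d < n)
    (h : ∀ j : Fin n, G.Adj v j ↔ (j : ℕ) = a ∨ (j : ℕ) = b ∨ (j : ℕ) = c ∨ (j : ℕ) = d) :
    (G.neighborSet v).ncard = 4 := by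
  have : G.neighborSet v = (({⟨a, by omega⟩, ⟨b, by omega⟩, ⟨c, by omega⟩, ⟨d, hd⟩} :
      Finset (Fin n)) : Set (Fin n)) := by
    ext j
    simp [h, Fin.ext_iff]
  rw [this, Set.ncard_coe_finset]
  repeat rw [Finset.card_insert_of_notMem (by simp [Fin.ext_iff]; omega)]
  rfl

theorem twoPads_ncard_neighborSet {n s e : ℕ} (hn : n = 2 * s + 1 + e) (hs : 5 ≤ s) (he : e ≤ 1)
    (v : Fin n) : ((twoPads n s e).neighborSet v).ncard = 4 := by
  obtain ⟨v, hv⟩ := v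
  have key : ∀ a b c d : ℕ, (a < b ∧ b < c ∧ c < d ∧ d < n) →
      (∀ j < n, (v < j ∧ TwoPadsLT s e v j) ∨ (j < v ∧ TwoPadsLT s e j v) →
        j = a ∨ j = b ∨ j = c ∨ j = d) →
      (∀ j, j = a ∨ j = b ∨ j = c ∨ j = d →
        (v < j ∧ TwoPadsLT s e v j) ∨ (j < v ∧ TwoPadsLT s e j v)) →
      ((twoPads n s e).neighborSet ⟨v, hv⟩).ncard = 4 := fun a b c d h h₁ h₂ =>
    ncard_neighborSet_eq_four a b c d h.1 h.2.1 h.2.2.1 h.2.2.2 fun j => ⟨h₁ j j.2, h₂ j⟩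
  unfold TwoPadsLT at key
  obtain h | h | h | h | h | h | h | h | h | h | h | h | h :
      v = 0 ∨ v = 1 ∨ (2 ≤ v ∧ v + 3 ≤ s) ∨ v + 2 = s ∨ v + 1 = s ∨ v = s ∨ v = s + 1 ∨
      v = s + 2 ∨ (s + 3 ≤ v ∧ v + 2 ≤ 2 * s + e) ∨ (v + 1 = 2 * s + e ∧ e = 0) ∨
      (v + 1 = 2 * s + e ∧ e = 1) ∨ (v = 2 * s + e ∧ e = 0) ∨ (v = 2 * s + e ∧ e = 1) := by
    omega
  · refine key 1 2 (s - 2) s (by omega) ?_ ?_ <;>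
      clear key <;> grind (splits := 30)
  · refine key 0 2 3 (s - 1) (by omega) ?_ ?_ <;>
      clear key <;> grind (splits := 30)
  · refine key (v - 2) (v - 1) (v + 1) (v + 2) (by omega) ?_ ?_ <;>
      clear key <;> grind (splits := 30)
  · refine key 0 (v - 2) (v - 1) (v + 1) (by omega) ?_ ?_ <;>
      clear key <;> grind (splits := 30)
  · refine key 1 (v - 2) (v - 1) (v + 1) (by omega) ?_ ?_ <;>
      clear key <;> grind (splits := 30)
  · refine key 0 (s - 1) (s + 1) (2 * s + e) (by omega) ?_ ?_ <;>
      clear key <;> grind (splits := 30)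
  · refine key s (s + 2) (s + 3) (2 * s + 2 * e - 1) (by omega) ?_ ?_ <;>
      clear key <;> grind (splits := 30)
  · refine key (s + 1) (s + 3) (s + 4) (2 * s) (by omega) ?_ ?_ <;>
      clear key <;> grind (splits := 30)
  · refine key (v - 2) (v - 1) (v + 1) (v + 2) (by omega) ?_ ?_ <;>
      clear key <;> grind (splits := 30)
  · refine key (s + 1) (v - 2) (v - 1) (v + 1) (by omega) ?_ ?_ <;>
      clear key <;> grind (splits := 30)
  · refine key (s + 2) (v - 2) (v - 1) (v + 1) (by omega) ?_ ?_ <;>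
      clear key <;> grind (splits := 30)
  · refine key s (s + 2) (v - 2) (v - 1) (by omega) ?_ ?_ <;>
      clear key <;> grind (splits := 30)
  · refine key s (s + 1) (v - 2) (v - 1) (by omega) ?_ ?_ <;>
      clear key <;> grind (splits := 30)

theorem exists_four_regular_not_doublyEulerian (n : ℕ) (hn : 11 ≤ n) :
    ∃ G : SimpleGraph (Fin n), G.Connected ∧
      (∀ v : Fin n, (G.neighborSet v).ncard = 4) ∧ ¬ DoublyEulerian G := by
  obtain ⟨s, e, he, hs, hse⟩ : ∃ s e, e ≤ 1 ∧ 5 ≤ s ∧ n = 2 * s + 1 + e :=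
    ⟨(n - 1) / 2, (n - 1) % 2, by omega, by omega, by omega⟩
  have hG := twoPads_ncard_neighborSet hse hs he
  refine ⟨twoPads n s e, twoPads_connected hse, hG, ?_⟩
  let u : Fin n := ⟨s, by omega⟩
  have hAcard : (Finset.Iio u).card = s := by simp [u]
  have hBcard : (Finset.Ioi u).card = s + e := by simp [u]; omega
  refine not_doublyEulerian_of_cut_vertex hG (u := u) (A := Finset.Iio u) (B := Finset.Ioi u)
    (Finset.card_pos.1 (by omega)) (Finset.card_pos.1 (by omega)) (by simp) (by simp) ?_ ?_ ?_ ?_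
  · rw [Finset.disjoint_left]
    simp only [Finset.mem_Iio, Finset.mem_Ioi]
    exact fun _ h => h.not_gt
  · intro x
    simp only [Finset.mem_Iio, Finset.mem_Ioi]
    rcases lt_trichotomy x u with h | h | h <;> tauto
  · intro x hx y hy h
    simp only [Finset.mem_Iio, Finset.mem_Ioi, Fin.lt_def, u] at hx hy
    rw [twoPads_adj] at h
    unfold TwoPadsLT at h
    omega
  · rcases Nat.le_one_iff_eq_zero_or_eq_one.1 he with rfl | rfl
    · left
      omega
    · right
      refine ⟨by omega, fun x hx y hy hux huy => ?_⟩
      have hends : ∀ z ∈ Finset.Ioi u, (twoPads n s 1).Adj u z →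
          (z : ℕ) = s + 1 ∨ (z : ℕ) = 2 * s + 1 := by
        intro z hz h
        simp only [Finset.mem_Ioi, Fin.lt_def, u] at hz
        rw [twoPads_adj] at h
        unfold TwoPadsLT at h
        simp only [u] at h
        omega
      have hends_adj : TwoPadsLT s 1 (s + 1) (2 * s + 1) :=
        .inr (.inr (.inr ⟨by omega, .inr (.inr (.inl ⟨rfl, rfl⟩))⟩))
      rw [Fin.ext_iff, twoPads_adj]
      rcases hends x hx hux with h | h <;> rcases hends y hy huy with h' | h' <;> rw [h, h']
      · exact .inl rfl
      · exact .inr (.inl ⟨by omega, hends_adj⟩)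
      · exact .inr (.inr ⟨by omega, hends_adj⟩)
      · exact .inl rfl
end
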